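/- Let η > 0 and let H ∈ C(ℝⁿ) be quasi-convex (every sub-level set {p : H(p) ≤ λ} is convex) with all sub-level sets bounded. Let ε ∈ (0,1), [λ,Λ] ⊆ (0,∞), and let u, v ∈ C(B₁^{n−1}×(−1,1)) be Lipschitz continuous on B₁^{n−1}×(−1,0] and satisfy: (C') the functions x' ↦ u(x',0) + (1/(2ε))|x'|² and x' ↦ −v(x',0) + (1/(2ε))|x'|² are convex on B₁^{n−1}; (UE') both u and v satisfy, in the viscosity sense in B₁^{n−1}×(0,1), M⁺_{λ,Λ}(D²w) + Λ|Dw| + Λw₊ + Λ ≥ 0 and M⁻_{λ,Λ}(D²w) − Λ|Dw| − Λw₋ − Λ ≤ 0; (Sub') u is a viscosity sub-solution of H(Du) + η ≤ 0 on B₁^{n−1}×(−1,0]; (Sup') v is a viscosity super-solution of H(Dv) ≥ 0 on B₁^{n−1}×(−1,0]. Then u cannot touch v from below at the origin; that is, it is not the case that u ≤ v on B₁^{n−1}×(−1,1) with u(0) = v(0). -/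

import Mathlib

open Metric Set Filter Topology Bornology

noncomputable section

abbrev Euc (n : ℕ) := EuclideanSpace ℝ (Fin n)

/-- Hessian matrix of a function at a point (second iterated Fréchet derivative,
a purely local notion). -/
def hessianMatrix {n : ℕ} (φ : Euc n → ℝ) (x : Euc n) : Matrix (Fin n) (Fin n) ℝ :=
  Matrix.of fun i j =>
    iteratedFDeriv ℝ 2 φ x ![EuclideanSpace.single i (1 : ℝ), EuclideanSpace.single j (1 : ℝ)]

/-- The set of symmetric matrices `A` with `λ I ≤ A ≤ Λ I`. -/
def pucciSet (n : ℕ) (l L : ℝ) : Set (Matrix (Fin n) (Fin n) ℝ) :=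
  {A | (A - l • (1 : Matrix (Fin n) (Fin n) ℝ)).PosSemidef ∧
       ((L • (1 : Matrix (Fin n) (Fin n) ℝ)) - A).PosSemidef}

/-- Pucci maximal operator `𝓜⁺_{λ,Λ}`. -/
def pucciPlus {n : ℕ} (l L : ℝ) (M : Matrix (Fin n) (Fin n) ℝ) : ℝ :=
  sSup ((fun A : Matrix (Fin n) (Fin n) ℝ => -(A * M).trace) '' pucciSet n l L)

/-- Pucci minimal operator `𝓜⁻_{λ,Λ}`. -/
def pucciMinus {n : ℕ} (l L : ℝ) (M : Matrix (Fin n) (Fin n) ℝ) : ℝ :=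
  sInf ((fun A : Matrix (Fin n) (Fin n) ℝ => -(A * M).trace) '' pucciSet n l L)

/-- `𝓜⁺_{λ,Λ}(D²u) + Λ|Du| + Λu₊ + Λ ≥ 0` in `V` in the viscosity sense. -/
def ViscPucciSuper {n : ℕ} (l L : ℝ) (V : Set (Euc n)) (u : Euc n → ℝ) : Prop :=
  ∀ x₀ : Euc n, ∀ φ : Euc n → ℝ, ∀ r : ℝ,
    0 < r → ball x₀ r ⊆ V → ContDiffOn ℝ 2 φ (ball x₀ r) →
    (∀ x ∈ ball x₀ r, φ x ≤ u x) → u x₀ = φ x₀ →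
    0 ≤ pucciPlus l L (hessianMatrix φ x₀) + L * ‖gradient φ x₀‖ + L * max (u x₀) 0 + L

/-- `𝓜⁻_{λ,Λ}(D²u) − Λ|Du| − Λu₋ − Λ ≤ 0` in `V` in the viscosity sense. -/
def ViscPucciSub {n : ℕ} (l L : ℝ) (V : Set (Euc n)) (u : Euc n → ℝ) : Prop :=
  ∀ x₀ : Euc n, ∀ φ : Euc n → ℝ, ∀ r : ℝ,
    0 < r → ball x₀ r ⊆ V → ContDiffOn ℝ 2 φ (ball x₀ r) →
    (∀ x ∈ ball x₀ r, u x ≤ φ x) → u x₀ = φ x₀ →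
    pucciMinus l L (hessianMatrix φ x₀) - L * ‖gradient φ x₀‖ - L * max (-(u x₀)) 0 - L ≤ 0

/-- Append a last coordinate to a vector of `ℝⁿ`, producing a vector of `ℝⁿ⁺¹`. -/
def snocE {n : ℕ} (p : Euc n) (t : ℝ) : Euc (n + 1) :=
  (EuclideanSpace.equiv (Fin (n + 1)) ℝ).symm (Fin.snoc (fun i => p i) t)

/-- `φ` is an admissible C² test function touching `u` from above at `x₀` on `ball x₀ r ⊆ Ω`. -/
def SubTest {n : ℕ} (Ω : Set (Euc n)) (u : Euc n → ℝ) (x₀ : Euc n)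
    (φ : Euc n → ℝ) (r : ℝ) : Prop :=
  0 < r ∧ ball x₀ r ⊆ Ω ∧ ContDiffOn ℝ 2 φ (ball x₀ r) ∧
    (∀ x ∈ ball x₀ r, u x ≤ φ x) ∧ u x₀ = φ x₀

/-- `φ` is an admissible C² test function touching `u` from below at `x₀` on `ball x₀ r ⊆ Ω`. -/
def SupTest {n : ℕ} (Ω : Set (Euc n)) (u : Euc n → ℝ) (x₀ : Euc n)
    (φ : Euc n → ℝ) (r : ℝ) : Prop :=
  0 < r ∧ ball x₀ r ⊆ Ω ∧ ContDiffOn ℝ 2 φ (ball x₀ r) ∧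
    (∀ x ∈ ball x₀ r, φ x ≤ u x) ∧ u x₀ = φ x₀

/-- The slab `B₁ⁿ⁻¹ × (-1, 1)`. -/
def slab (n : ℕ) : Set (Euc (n + 1)) :=
  {x | (∑ i : Fin n, (x i.castSucc) ^ 2) < 1 ∧ |x (Fin.last n)| < 1}

/-- The lower part `B₁ⁿ⁻¹ × (-1, 0]` of the slab. -/
def slabLe (n : ℕ) : Set (Euc (n + 1)) :=
  {x | (∑ i : Fin n, (x i.castSucc) ^ 2) < 1 ∧ -1 < x (Fin.last n) ∧ x (Fin.last n) ≤ 0}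

/-- The upper open part `B₁ⁿ⁻¹ × (0, 1)` of the slab. -/
def slabPos (n : ℕ) : Set (Euc (n + 1)) :=
  {x | (∑ i : Fin n, (x i.castSucc) ^ 2) < 1 ∧ 0 < x (Fin.last n) ∧ x (Fin.last n) < 1}

section Jets

open MeasureTheory Module
open scoped RealInnerProductSpace

variable {E : Type*} [NormedAddCommGroup E] [InnerProductSpace ℝ E]

/-- The inequality `𝓜⁺(D²z) + K₁|Dz| + K₀ ≥ 0` in `V` in the viscosity sense, tested only with
quadratic polynomials whose Hessian is `2 e ⊗ e - 2 γ I`. -/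
def PucciJetSuper (C K₁ K₀ : ℝ) (V : Set E) (z : E → ℝ) : Prop :=
  ∀ x ∈ V, ∀ g e : E, ∀ γ : ℝ, 0 ≤ γ →
    (∀ᶠ y in 𝓝 x, z x + ⟪g, y - x⟫ + ⟪e, y - x⟫ ^ 2 - γ * ‖y - x‖ ^ 2 ≤ z y) →
    ‖e‖ ^ 2 ≤ C * γ + K₁ * ‖g‖ + K₀

/-- Every gradient of a paraboloid touching `z` from below at a point of `S` lies in `Z`. -/
def JetBelow (z : E → ℝ) (S Z : Set E) : Prop :=
  ∀ x ∈ S, ∀ g : E, ∀ A : ℝ,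
    (∀ᶠ y in 𝓝 x, z x + ⟪g, y - x⟫ - A * ‖y - x‖ ^ 2 ≤ z y) → g ∈ Z

theorem PucciJetSuper.mono {C K₁ K₀ K₁' K₀' : ℝ} {V V' : Set E} {z : E → ℝ}
    (h : PucciJetSuper C K₁ K₀ V z) (h₁ : K₁ ≤ K₁') (h₀ : K₀ ≤ K₀') (hV : V' ⊆ V) :
    PucciJetSuper C K₁' K₀' V' z := by
  intro x hx g e γ hγ hy
  have := h x (hV hx) g e γ hγ hy
  have := mul_le_mul_of_nonneg_right h₁ (norm_nonneg g)
  linarith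

theorem PucciJetSuper.comp_affine {C K₁ K₀ : ℝ} {V : Set E} {z : E → ℝ}
    (h : PucciJetSuper C K₁ K₀ V z) (hK : 0 ≤ K₁) {s r : ℝ} (hs : 0 < s) (hr : 0 < r)
    (b a : E) (c : ℝ) :
    PucciJetSuper C (K₁ * r) (K₀ * s * r ^ 2 + K₁ * r * ‖a‖) {y | b + r • y ∈ V}
      (fun y => s * z (b + r • y) + ⟪a, y⟫ + c) := by
  intro x hx g e γ hγ hy
  have key := h (b + r • x) hx ((s * r)⁻¹ • (g - a)) ((r * √s)⁻¹ • e) (γ / (s * r ^ 2))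
    (by positivity) ?_
  · rw [norm_smul, norm_smul, mul_pow, Real.norm_of_nonneg (by positivity),
      Real.norm_of_nonneg (by positivity)] at key
    have e1 : ((r * √s)⁻¹) ^ 2 = (s * r ^ 2)⁻¹ := by
      rw [inv_pow, mul_pow, Real.sq_sqrt hs.le, mul_comm]
    rw [e1] at key
    have hpos : 0 < s * r ^ 2 := by positivity
    have k2 := mul_le_mul_of_nonneg_left key hpos.le
    have e2 : s * r ^ 2 * ((s * r ^ 2)⁻¹ * ‖e‖ ^ 2) = ‖e‖ ^ 2 := by field_simp
    have e3 : s * r ^ 2 * (C * (γ / (s * r ^ 2)) + K₁ * ((s * r)⁻¹ * ‖g - a‖) + K₀)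
        = C * γ + K₁ * r * ‖g - a‖ + K₀ * s * r ^ 2 := by field_simp
    rw [e2, e3] at k2
    have := mul_le_mul_of_nonneg_left (norm_sub_le g a) (by positivity : 0 ≤ K₁ * r)
    linarith
  · have ht : Tendsto (fun Y : E => r⁻¹ • (Y - b)) (𝓝 (b + r • x)) (𝓝 x) := by
      have : Continuous (fun Y : E => r⁻¹ • (Y - b)) := by fun_prop
      have h2 := this.tendsto (b + r • x)
      simpa [smul_smul, inv_mul_cancel₀ hr.ne'] using h2
    filter_upwards [ht.eventually hy] with Y hY
    have eY : b + r • (r⁻¹ • (Y - b)) = Y := by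
      rw [smul_smul, mul_inv_cancel₀ hr.ne']; simp
    have ed : r⁻¹ • (Y - b) - x = r⁻¹ • (Y - (b + r • x)) := by
      rw [smul_sub, smul_sub, smul_add, smul_smul r⁻¹ r, inv_mul_cancel₀ hr.ne', one_smul]
      abel
    have ea : ⟪a, r⁻¹ • (Y - b)⟫ = ⟪a, x⟫ + r⁻¹ * ⟪a, Y - (b + r • x)⟫ := by
      rw [← real_inner_smul_right, ← ed, ← inner_add_right]; congr 1; abel
    rw [eY, ea, ed, norm_smul, inner_smul_right, inner_smul_right,
      Real.norm_of_nonneg (by positivity)] at hY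
    rw [inner_smul_left, inner_smul_left, inner_sub_left]
    set D := Y - (b + r • x)
    simp only [RCLike.conj_to_real]
    have e1 : ((r * √s)⁻¹ * ⟪e, D⟫) ^ 2 = s⁻¹ * (r⁻¹ * ⟪e, D⟫) ^ 2 := by
      rw [mul_pow, mul_pow, inv_pow, inv_pow, mul_pow, Real.sq_sqrt hs.le]; field_simp
    rw [e1]
    have hY' : s * z (b + r • x) + r⁻¹ * ⟪g, D⟫ + (r⁻¹ * ⟪e, D⟫) ^ 2 - γ * (r⁻¹ * ‖D‖) ^ 2
      - r⁻¹ * ⟪a, D⟫ ≤ s * z Y := by linarith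
    have := mul_le_mul_of_nonneg_left hY' (inv_pos.2 hs).le
    rw [inv_mul_cancel_left₀ hs.ne'] at this
    refine le_trans (le_of_eq ?_) this
    field_simp
    ring

/-- At an interior minimum point of `z - φ`, a quadratic jet of `φ` from below is one of `z`. -/
theorem PucciJetSuper.of_isMinOn {C K₁ K₀ : ℝ} {V G : Set E} {z φ : E → ℝ} {x : E}
    (h : PucciJetSuper C K₁ K₀ V z) (hx : x ∈ V) (hG : G ∈ 𝓝 x)
    (hmin : ∀ y ∈ G, z x - φ x ≤ z y - φ y) {g e : E} {γ : ℝ} (hγ : 0 ≤ γ)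
    (hφ : ∀ᶠ y in 𝓝 x, φ x + ⟪g, y - x⟫ + ⟪e, y - x⟫ ^ 2 - γ * ‖y - x‖ ^ 2 ≤ φ y) :
    ‖e‖ ^ 2 ≤ C * γ + K₁ * ‖g‖ + K₀ := by
  refine h x hx g e γ hγ ?_
  filter_upwards [hG, hφ] with y hy h1
  linarith [hmin y hy]

theorem JetBelow.of_isMinOn {S Z G : Set E} {z φ : E → ℝ} {x : E}
    (h : JetBelow z S Z) (hx : x ∈ S) (hG : G ∈ 𝓝 x)
    (hmin : ∀ y ∈ G, z x - φ x ≤ z y - φ y) {g : E} {A : ℝ}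
    (hφ : ∀ᶠ y in 𝓝 x, φ x + ⟪g, y - x⟫ - A * ‖y - x‖ ^ 2 ≤ φ y) : g ∈ Z := by
  refine h x hx g A ?_
  filter_upwards [hG, hφ] with y hy h1
  linarith [hmin y hy]

theorem exp_ge_quadratic {t : ℝ} (ht : -2 ≤ t) : 1 + t + t ^ 2 / 4 ≤ Real.exp t := by
  have h := Real.add_one_le_exp (t / 2)
  have e : Real.exp t = Real.exp (t / 2) ^ 2 := by rw [← Real.exp_nat_mul]; congr 1; push_cast; ring
  rw [e]
  nlinarith

theorem gaussian_jet {α : ℝ} (hα : 1 ≤ α) (c x : E) :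
    ∀ᶠ y in 𝓝 x, Real.exp (-α * ‖x - c‖ ^ 2) * (1 - 2 * α * ⟪x - c, y - x⟫ +
      α ^ 2 / 2 * ⟪x - c, y - x⟫ ^ 2 - 2 * α * ‖y - x‖ ^ 2) ≤ Real.exp (-α * ‖y - c‖ ^ 2) := by
  have c1 : ∀ᶠ y in 𝓝 x, -2 < -α * (2 * ⟪x - c, y - x⟫ + ‖y - x‖ ^ 2) := by
    have : Continuous fun y => -α * (2 * ⟪x - c, y - x⟫ + ‖y - x‖ ^ 2) := by fun_prop
    refine this.continuousAt.eventually_const_lt ?_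
    simp
  have c2 : ∀ᶠ y in 𝓝 x, α * ‖y - x‖ ^ 2 < 1 := by
    have : Continuous fun y => α * ‖y - x‖ ^ 2 := by fun_prop
    refine this.continuousAt.eventually_lt_const ?_
    simp
  filter_upwards [c1, c2] with y h1 h2
  have e1 : ‖y - c‖ ^ 2 = ‖x - c‖ ^ 2 + (2 * ⟪x - c, y - x⟫ + ‖y - x‖ ^ 2) := by
    have : y - c = (x - c) + (y - x) := by abel
    rw [this, norm_add_sq_real]; ring
  rw [e1, mul_add, Real.exp_add]
  refine mul_le_mul_of_nonneg_left ?_ (Real.exp_pos _).le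
  refine le_trans ?_ (exp_ge_quadratic h1.le)
  set a := ⟪x - c, y - x⟫
  set n := ‖y - x‖ ^ 2
  have hn : 0 ≤ n := by positivity
  have h3 : α ^ 2 / 4 * n ^ 2 ≤ α * n := by
    have : α * n * (α * n) ≤ α * n * 1 := mul_le_mul_of_nonneg_left h2.le (by positivity)
    nlinarith
  have h4 : (2 * a) ^ 2 / 2 - n ^ 2 ≤ (2 * a + n) ^ 2 := by nlinarith [sq_nonneg (a + n)]
  have h5 := mul_le_mul_of_nonneg_left h4 (by positivity : 0 ≤ α ^ 2 / 4)
  nlinarith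

theorem exp_barrier {C ρ R : ℝ} (hC : 0 ≤ C) (hρ : 0 < ρ) (hR : 0 < R) :
    ∃ α k₀ : ℝ, 1 ≤ α ∧ 0 < k₀ ∧ ∀ (ζ : E → ℝ) (c : E) (m κ : ℝ) (G V : Set E), 0 < κ →
      IsCompact G → (∀ x ∈ G, ρ ≤ ‖x - c‖ ∧ ‖x - c‖ ≤ R) → ContinuousOn ζ G →
      PucciJetSuper C 1 (κ * k₀) V ζ →
      (∀ x ∈ G, (x ∈ V ∧ G ∈ 𝓝 x) ∨ κ * (Real.exp (-α * ‖x - c‖ ^ 2) - m) ≤ ζ x) →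
      ∀ x ∈ G, κ * (Real.exp (-α * ‖x - c‖ ^ 2) - m) ≤ ζ x := by
  set α := 1 + 2 * (2 * C + 2 * R + 2) / ρ ^ 2 with hα
  have hα1 : 1 ≤ α := by rw [hα]; have : 0 ≤ 2 * (2 * C + 2 * R + 2) / ρ ^ 2 := by positivity
                         linarith
  have hα2 : 2 * C + 2 * R + 2 ≤ α * ρ ^ 2 / 2 := by
    rw [hα, add_mul, div_mul_cancel₀ _ (by positivity)]; nlinarith [sq_nonneg ρ]
  refine ⟨α, Real.exp (-α * R ^ 2), hα1, Real.exp_pos _, ?_⟩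
  intro ζ c m κ G V hκ hG hd hζ hV hb x hx
  by_contra hcon
  push Not at hcon
  set φ : E → ℝ := fun y => κ * (Real.exp (-α * ‖y - c‖ ^ 2) - m) with hφ
  have hφc : Continuous φ := by fun_prop
  obtain ⟨w, hwG, hw⟩ := hG.exists_isMinOn ⟨x, hx⟩ (hζ.sub hφc.continuousOn)
  have hwm : ∀ y ∈ G, ζ w - φ w ≤ ζ y - φ y := fun y hy => hw hy
  have hwneg : ζ w - φ w < 0 := lt_of_le_of_lt (hwm x hx) (by simp only [hφ]; linarith)
  rcases hb w hwG with ⟨hwV, hwn⟩ | hle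
  swap
  · simp only [hφ] at hwneg; linarith
  set F := Real.exp (-α * ‖w - c‖ ^ 2) with hF
  have hFpos : 0 < F := Real.exp_pos _
  have hα0 : 0 < α := by linarith
  have key := hV.of_isMinOn (φ := φ) hwV hwn hwm (g := (-(2 * α * (κ * F))) • (w - c))
    (e := (√(κ * F / 2) * α) • (w - c)) (γ := 2 * α * (κ * F)) (by positivity) (by
    filter_upwards [gaussian_jet hα1 c w] with y hy
    have := mul_le_mul_of_nonneg_left hy hκ.le
    simp only [hφ, inner_smul_left, RCLike.conj_to_real]
    rw [mul_pow, mul_pow, Real.sq_sqrt (by positivity)]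
    rw [← hF] at this ⊢
    linarith)
  rw [norm_smul, norm_smul, mul_pow, norm_neg, Real.norm_of_nonneg (by positivity),
      Real.norm_of_nonneg (by positivity), mul_pow, Real.sq_sqrt (by positivity)] at key
  obtain ⟨h1, h2⟩ := hd w hwG
  have hFR : Real.exp (-α * R ^ 2) ≤ F := by
    apply Real.exp_le_exp.2
    have : ‖w - c‖ ^ 2 ≤ R ^ 2 := by gcongr
    nlinarith
  have h3 : ρ ^ 2 ≤ ‖w - c‖ ^ 2 := by gcongr
  have hP : 0 < κ * F := by positivity
  have a1 : κ * F * α * (α * ρ ^ 2 / 2) ≤ κ * F / 2 * α ^ 2 * ‖w - c‖ ^ 2 := by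
    have := mul_le_mul_of_nonneg_left h3 (by positivity : 0 ≤ κ * F / 2 * α ^ 2)
    nlinarith
  have a2 : κ * F * α * (2 * C + 2 * R + 2) ≤ κ * F * α * (α * ρ ^ 2 / 2) :=
    mul_le_mul_of_nonneg_left hα2 (by positivity)
  have a3 : 1 * (2 * α * (κ * F) * ‖w - c‖) ≤ κ * F * α * (2 * R) := by
    have := mul_le_mul_of_nonneg_left h2 (by positivity : 0 ≤ 2 * α * (κ * F))
    nlinarith
  have a4 : κ * Real.exp (-α * R ^ 2) ≤ κ * F * α * 1 := by
    have : κ * Real.exp (-α * R ^ 2) ≤ κ * F := by gcongr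
    nlinarith
  have a5 : 0 < κ * F * α := by positivity
  nlinarith

end Jets

section ContactSet

open MeasureTheory Module
open scoped RealInnerProductSpace

variable {E : Type*} [NormedAddCommGroup E] [InnerProductSpace ℝ E]

set_option maxHeartbeats 1000000 in
/-- The map from vertices of touching paraboloids to contact points is expansive. -/
theorem contact_expansive [FiniteDimensional ℝ E] {C : ℝ} (hC : 0 ≤ C) :
    ∃ L : NNReal, ∀ ζ : E → ℝ, ContinuousOn ζ (closedBall 0 1) →
      PucciJetSuper C 1 1 (ball 0 1) ζ → ∀ x₁ x₂ y₁ y₂ : E, ‖x₁‖ ≤ 7 / 8 → ‖x₂‖ ≤ 7 / 8 →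
      ‖y₁‖ ≤ 1 / 8 → ‖y₂‖ ≤ 1 / 8 →
      (∀ x ∈ closedBall (0 : E) 1, ζ x₁ + 2 * ‖x₁ - y₁‖ ^ 2 ≤ ζ x + 2 * ‖x - y₁‖ ^ 2) →
      (∀ x ∈ closedBall (0 : E) 1, ζ x₂ + 2 * ‖x₂ - y₂‖ ^ 2 ≤ ζ x + 2 * ‖x - y₂‖ ^ 2) →
      ‖y₁ - y₂‖ ≤ L * ‖x₁ - x₂‖ := by
  set R := 1 + 6 * C with hR
  have hR1 : 1 ≤ R := by linarith
  have hL0 : 0 < (R + 1) * (2 * C + 8) := by positivity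
  refine ⟨Real.toNNReal ((R + 1) * (2 * C + 8)), ?_⟩
  intro ζ hζ hV x₁ x₂ y₁ y₂ hx₁ hx₂ hy₁ hy₂ h₁ h₂
  rw [Real.coe_toNNReal _ hL0.le]
  by_contra! hcon
  set L := (R + 1) * (2 * C + 8) with hL
  have hL4 : 4 * R ≤ L := by nlinarith
  set q := y₁ - y₂ with hq
  set s := ‖q‖ with hs
  have hs4 : s ≤ 1 / 4 := by have := norm_sub_le y₁ y₂; rw [← hq] at this; linarith
  have hd : ‖x₁ - x₂‖ < s / L := by rw [lt_div_iff₀ hL0]; linarith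
  obtain ⟨ρ, hρ1, hρ2⟩ := exists_between hd
  have hρ : 0 < ρ := (norm_nonneg _).trans_lt hρ1
  rw [lt_div_iff₀ hL0] at hρ2
  have hs0 : 0 < s := lt_trans (by positivity) hρ2
  have hRρ : R * ρ < 1 / 16 := by
    have := mul_le_mul_of_nonneg_left hL4 hρ.le
    linarith
  set P : E → E → E → ℝ := fun a b x => ζ a + 2 * ‖a - b‖ ^ 2 - 2 * ‖x - b‖ ^ 2 with hP
  have hP₁ : ∀ x ∈ closedBall (0 : E) 1, P x₁ y₁ x ≤ ζ x := fun x hx => by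
    have := h₁ x hx; simp only [hP]; linarith
  have hP₂ : ∀ x ∈ closedBall (0 : E) 1, P x₂ y₂ x ≤ ζ x := fun x hx => by
    have := h₂ x hx; simp only [hP]; linarith
  set l : E → ℝ := fun x => P x₁ y₁ x - P x₂ y₂ x with hl
  have hPexp : ∀ a b w y, P a b y = P a b w - 4 * ⟪w - b, y - w⟫ - 2 * ‖y - w‖ ^ 2 := by
    intro a b w y
    have : y - b = (w - b) + (y - w) := by abel
    simp only [hP]
    rw [this, norm_add_sq_real]; ring
  have hlexp : ∀ w y, l y = l w + 4 * ⟪q, y - w⟫ := by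
    intro w y
    simp only [hl]
    rw [hPexp x₁ y₁ w y, hPexp x₂ y₂ w y, hq]
    simp only [inner_sub_left]; ring
  have m₁ : x₁ ∈ closedBall (0 : E) 1 := by rw [mem_closedBall_zero_iff]; linarith
  have m₂ : x₂ ∈ closedBall (0 : E) 1 := by rw [mem_closedBall_zero_iff]; linarith
  have e₁ : P x₁ y₁ x₁ = ζ x₁ := by simp [hP]
  have e₂ : P x₂ y₂ x₂ = ζ x₂ := by simp [hP]
  have l1 : 0 ≤ l x₁ := by have := hP₂ x₁ m₁; simp only [hl]; linarith
  have l2 : l x₂ ≤ 0 := by have := hP₁ x₂ m₂; simp only [hl]; linarith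
  have l3 : l x₁ ≤ 4 * s * ρ := by
    rw [hlexp x₂ x₁]
    have := real_inner_le_norm q (x₁ - x₂)
    have : ‖q‖ * ‖x₁ - x₂‖ ≤ s * ρ := by gcongr
    linarith
  set m := 4 * s * (R + 1) * ρ with hm
  have hm0 : 0 < m := by positivity
  have hlm : ∀ x ∈ closedBall x₁ (R * ρ), |l x| ≤ m := by
    intro x hx
    rw [mem_closedBall, dist_eq_norm] at hx
    rw [hlexp x₁ x, abs_le]
    have h := abs_real_inner_le_norm q (x - x₁)
    have h' : ‖q‖ * ‖x - x₁‖ ≤ s * (R * ρ) := by gcongr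
    have := abs_le.1 (h.trans h')
    constructor <;> nlinarith
  set γ₀ := 3 * s / (R ^ 2 * ρ) with hγ₀
  have hγ0 : 0 < γ₀ := by positivity
  have hγR : γ₀ * (R * ρ) ^ 2 = 3 * s * ρ := by rw [hγ₀]; field_simp
  set φ : E → ℝ := fun x => (P x₁ y₁ x + P x₂ y₂ x) / 2 + (l x) ^ 2 / (2 * m)
    - γ₀ * ‖x - x₁‖ ^ 2 with hφ
  have hsub : closedBall x₁ (R * ρ) ⊆ ball (0 : E) 1 := by
    intro x hx
    rw [mem_closedBall, dist_eq_norm] at hx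
    rw [mem_ball_zero_iff]
    have : ‖x‖ ≤ ‖x₁‖ + ‖x - x₁‖ := by
      have := norm_add_le x₁ (x - x₁); simpa using this
    linarith
  have hlow : ∀ x ∈ closedBall x₁ (R * ρ), γ₀ * ‖x - x₁‖ ^ 2 ≤ ζ x - φ x := by
    intro x hx
    have hx' := ball_subset_closedBall (hsub hx)
    have a1 := hP₁ x hx'
    have a2 := hP₂ x hx'
    have a3 := hlm x hx
    have a4 : (l x) ^ 2 / (2 * m) ≤ |l x| / 2 := by
      rw [div_le_div_iff₀ (by positivity) (by positivity), ← sq_abs]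
      nlinarith [abs_nonneg (l x)]
    have a5 : |l x| ≤ 2 * ζ x - P x₁ y₁ x - P x₂ y₂ x := by
      rw [abs_le]; simp only [hl]; constructor <;> linarith
    simp only [hφ]
    linarith
  have hφc : Continuous φ := by
    simp only [hφ, hl, hP]; fun_prop
  have x1m : x₁ ∈ closedBall x₁ (R * ρ) := mem_closedBall_self (by positivity)
  obtain ⟨w, hwG, hw⟩ := (isCompact_closedBall x₁ (R * ρ)).exists_isMinOn ⟨x₁, x1m⟩
    ((hζ.mono (hsub.trans ball_subset_closedBall)).sub hφc.continuousOn)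
  have hwm : ∀ y ∈ closedBall x₁ (R * ρ), ζ w - φ w ≤ ζ y - φ y := fun y hy => hw hy
  have hw1 : ζ x₁ - φ x₁ ≤ 2 * s * ρ := by
    have : 0 ≤ (l x₁) ^ 2 / (2 * m) := by positivity
    simp only [hφ, sub_self, norm_zero]
    have : P x₂ y₂ x₁ = P x₁ y₁ x₁ - l x₁ := by simp only [hl]; ring
    rw [this, e₁]
    nlinarith
  have hwR : ‖w - x₁‖ < R * ρ := by
    have b1 := (hlow w hwG).trans ((hwm x₁ x1m).trans hw1)
    have b2 : γ₀ * ‖w - x₁‖ ^ 2 < γ₀ * (R * ρ) ^ 2 := by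
      rw [hγR]; nlinarith [mul_pos hs0 hρ]
    exact lt_of_pow_lt_pow_left₀ 2 (by positivity) (lt_of_mul_lt_mul_left b2 hγ0.le)
  have hwn : closedBall x₁ (R * ρ) ∈ 𝓝 w :=
    mem_of_superset (isOpen_ball.mem_nhds (by rwa [mem_ball, dist_eq_norm])) ball_subset_closedBall
  set g : E := -(2 : ℝ) • ((w - y₁) + (w - y₂)) + (4 * l w / m) • q - (2 * γ₀) • (w - x₁) with hg
  set e : E := (4 / √(2 * m)) • q with he
  have key := hV.of_isMinOn (φ := φ) (hsub hwG) hwn hwm (g := g) (e := e) (γ := 2 + γ₀)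
    (by positivity) (by
    refine Eventually.of_forall fun y => le_of_eq ?_
    simp only [hφ]
    rw [hPexp x₁ y₁ w y, hPexp x₂ y₂ w y, hlexp w y]
    have : y - x₁ = (w - x₁) + (y - w) := by abel
    rw [this, norm_add_sq_real, hg, he]
    simp only [inner_add_left, inner_sub_left (_ + _) , inner_smul_left, RCLike.conj_to_real]
    rw [mul_pow, div_pow, Real.sq_sqrt (by positivity)]
    field_simp
    ring)
  have hgn : ‖g‖ ≤ 7 := by
    have hw78 : ‖w‖ ≤ 1 := by have := hsub hwG; rw [mem_ball_zero_iff] at this; exact this.le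
    have n1 : ‖-(2 : ℝ) • ((w - y₁) + (w - y₂))‖ ≤ 2 * (2 + 1 / 4) := by
      rw [norm_smul, Real.norm_eq_abs, abs_neg, abs_two]
      have := norm_add_le (w - y₁) (w - y₂)
      have := norm_sub_le w y₁
      have := norm_sub_le w y₂
      linarith
    have n2 : ‖(4 * l w / m) • q‖ ≤ 1 := by
      rw [norm_smul, Real.norm_eq_abs, abs_div, abs_mul, abs_of_pos hm0, abs_of_pos (by norm_num)]
      have := hlm w hwG
      have : 4 * |l w| / m ≤ 4 := by rw [div_le_iff₀ hm0]; linarith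
      nlinarith [norm_nonneg q]
    have n3 : ‖(2 * γ₀) • (w - x₁)‖ ≤ 3 / 2 := by
      rw [norm_smul, Real.norm_of_nonneg (by positivity)]
      have : 2 * γ₀ * ‖w - x₁‖ ≤ 2 * γ₀ * (R * ρ) := by gcongr
      have e : 2 * γ₀ * (R * ρ) = 6 * s / R := by rw [hγ₀]; field_simp; norm_num
      have : 6 * s / R ≤ 3 / 2 := by rw [div_le_iff₀ (by positivity)]; nlinarith
      linarith
    calc ‖g‖ ≤ _ := norm_sub_le _ _
      _ ≤ _ := add_le_add_left (norm_add_le _ _) _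
      _ ≤ _ := by linarith
  have hen : ‖e‖ ^ 2 = 2 * s / ((R + 1) * ρ) := by
    rw [he, norm_smul, mul_pow, Real.norm_of_nonneg (by positivity), div_pow,
      Real.sq_sqrt (by positivity), hm, ← hs]
    field_simp
    norm_num
  rw [hen, div_le_iff₀ (by positivity)] at key
  have k1 : C * γ₀ * ((R + 1) * ρ) ≤ s := by
    have : C * γ₀ * ((R + 1) * ρ) = s * (3 * C * (R + 1)) / R ^ 2 := by rw [hγ₀]; field_simp
    rw [this, div_le_iff₀ (by positivity)]
    refine mul_le_mul_of_nonneg_left ?_ hs0.le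
    rw [hR]; nlinarith
  have k2 : (1 * ‖g‖ + 1) * ((R + 1) * ρ) ≤ 8 * ((R + 1) * ρ) :=
    mul_le_mul_of_nonneg_right (by linarith) (by positivity)
  have : ρ * L = (2 * C + 8) * ((R + 1) * ρ) := by rw [hL]; ring
  nlinarith

/-- A substitute for the Aleksandrov–Bakelman–Pucci estimate. -/
theorem measure_contact [FiniteDimensional ℝ E] [MeasurableSpace E] [BorelSpace E]
    {C : ℝ} (hC : 0 ≤ C) :
    ∃ μ₀ : ENNReal, 0 < μ₀ ∧ ∀ ζ : E → ℝ, ContinuousOn ζ (closedBall 0 1) →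
      (∀ x ∈ closedBall (0 : E) 1, 0 ≤ ζ x) → PucciJetSuper C 1 1 (ball 0 1) ζ →
      (∃ x₀ ∈ closedBall (0 : E) (1 / 8), ζ x₀ ≤ 1) →
      μ₀ ≤ μH[(finrank ℝ E : ℝ)] {x ∈ closedBall (0 : E) 1 | ζ x ≤ 2} := by
  obtain ⟨L, hL⟩ := contact_expansive (E := E) hC
  set μ : Measure E := μH[(finrank ℝ E : ℝ)] with hμ
  have : μ.IsAddHaarMeasure := by rw [hμ]; infer_instance
  have hY : 0 < μ (closedBall (0 : E) (1 / 8)) := measure_closedBall_pos _ _ (by norm_num)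
  have hLt : ((L : ENNReal) ^ (finrank ℝ E : ℝ)) ≠ ⊤ := by
    simp
  refine ⟨μ (closedBall (0 : E) (1 / 8)) / (L : ENNReal) ^ (finrank ℝ E : ℝ),
    ENNReal.div_pos hY.ne' hLt, ?_⟩
  rintro ζ hζ hpos hV ⟨x₀, hx₀, hx₀1⟩
  rw [mem_closedBall_zero_iff] at hx₀
  have hex : ∀ y : E, ∃ x ∈ closedBall (0 : E) 1, ∀ x' ∈ closedBall (0 : E) 1,
      ζ x + 2 * ‖x - y‖ ^ 2 ≤ ζ x' + 2 * ‖x' - y‖ ^ 2 := by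
    intro y
    obtain ⟨w, hw, hwm⟩ := (isCompact_closedBall (0 : E) 1).exists_isMinOn
      ⟨0, mem_closedBall_self zero_le_one⟩
      (hζ.add (by fun_prop : Continuous fun x : E => 2 * ‖x - y‖ ^ 2).continuousOn)
    exact ⟨w, hw, fun x' hx' => hwm hx'⟩
  choose X hX hXm using hex
  have hval : ∀ y ∈ closedBall (0 : E) (1 / 8), ζ (X y) + 2 * ‖X y - y‖ ^ 2 ≤ 9 / 8 := by
    intro y hy
    rw [mem_closedBall_zero_iff] at hy
    have h1 := hXm y x₀ (by rw [mem_closedBall_zero_iff]; linarith)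
    have h2 := norm_sub_le x₀ y
    have : ‖x₀ - y‖ ^ 2 ≤ (1 / 4) ^ 2 := by gcongr; linarith
    linarith
  have hX78 : ∀ y ∈ closedBall (0 : E) (1 / 8), ‖X y‖ ≤ 7 / 8 := by
    intro y hy
    have h1 := hval y hy
    rw [mem_closedBall_zero_iff] at hy
    have h2 := hpos _ (hX y)
    have h3 : ‖X y - y‖ ≤ 3 / 4 := by
      refine le_of_sq_le_sq ?_ (by norm_num)
      linarith
    have := norm_add_le (X y - y) y
    rw [sub_add_cancel] at this
    linarith
  have hexp : ∀ y₁ ∈ closedBall (0 : E) (1 / 8), ∀ y₂ ∈ closedBall (0 : E) (1 / 8),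
      ‖y₁ - y₂‖ ≤ L * ‖X y₁ - X y₂‖ := fun y₁ h₁ y₂ h₂ =>
    hL ζ hζ hV _ _ y₁ y₂ (hX78 _ h₁) (hX78 _ h₂) (mem_closedBall_zero_iff.1 h₁)
      (mem_closedBall_zero_iff.1 h₂) (hXm _) (hXm _)
  have hinj : InjOn X (closedBall (0 : E) (1 / 8)) := by
    intro y₁ h₁ y₂ h₂ h
    have := hexp y₁ h₁ y₂ h₂
    rw [h, sub_self, norm_zero, mul_zero] at this
    exact sub_eq_zero.1 (norm_le_zero_iff.1 this)
  set T := X '' closedBall (0 : E) (1 / 8) with hT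
  set Y := Function.invFunOn X (closedBall (0 : E) (1 / 8)) with hYdef
  have hYX : ∀ y ∈ closedBall (0 : E) (1 / 8), Y (X y) = y := fun y hy =>
    hinj.leftInvOn_invFunOn hy
  have hLip : LipschitzOnWith L Y T := by
    rw [lipschitzOnWith_iff_norm_sub_le]
    rintro _ ⟨y₁, h₁, rfl⟩ _ ⟨y₂, h₂, rfl⟩
    rw [hYX _ h₁, hYX _ h₂]
    exact hexp y₁ h₁ y₂ h₂
  have hYT : closedBall (0 : E) (1 / 8) ⊆ Y '' T := fun y hy => ⟨X y, ⟨y, hy, rfl⟩, hYX y hy⟩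
  have hTs : T ⊆ {x ∈ closedBall (0 : E) 1 | ζ x ≤ 2} := by
    rintro _ ⟨y, hy, rfl⟩
    refine ⟨hX y, ?_⟩
    have := hval y hy
    nlinarith [sq_nonneg ‖X y - y‖]
  refine ENNReal.div_le_of_le_mul' ?_
  calc μ (closedBall (0 : E) (1 / 8)) ≤ μ (Y '' T) := measure_mono hYT
    _ ≤ L ^ (finrank ℝ E : ℝ) * μ T := hLip.hausdorffMeasure_image_le (by positivity)
    _ ≤ _ := by gcongr

end ContactSet

section InkSpots

open MeasureTheory Module
open scoped RealInnerProductSpace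

variable {E : Type*} [NormedAddCommGroup E] [InnerProductSpace ℝ E] [FiniteDimensional ℝ E]

theorem PucciJetSuper.growth {C ρ R' R : ℝ} (hC : 0 ≤ C) (hρ : 0 < ρ) (hρR : ρ < R') (hR : R' < R) :
    ∃ c : ℝ, 0 < c ∧ c ≤ 1 ∧ ∀ (ζ : E → ℝ) (p : E) (t K₀ : ℝ), 0 < t → K₀ ≤ c * t →
      ContinuousOn ζ (closedBall p R) → (∀ x ∈ closedBall p R, 0 ≤ ζ x) →
      PucciJetSuper C 1 K₀ (ball p R) ζ → (∀ x ∈ closedBall p ρ, t ≤ ζ x) →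
      ∀ x ∈ closedBall p R', c * t ≤ ζ x := by
  obtain ⟨α, k₀, hα, hk₀, H⟩ := exp_barrier (E := E) hC hρ (hρ.trans (hρR.trans hR))
  have hc1 : Real.exp (-α * R ^ 2) < Real.exp (-α * R' ^ 2) := by
    apply Real.exp_lt_exp.2
    have : R' ^ 2 < R ^ 2 := by gcongr; linarith
    nlinarith
  set c₁ := Real.exp (-α * R' ^ 2) - Real.exp (-α * R ^ 2) with hc₁
  refine ⟨min 1 (min k₀ c₁), by simp only [lt_min_iff]; refine ⟨by norm_num, hk₀, by linarith⟩,
    min_le_left _ _, ?_⟩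
  intro ζ p t K₀ ht hK hζ hpos hV hin x hx
  have m1 : min 1 (min k₀ c₁) ≤ 1 := min_le_left _ _
  have m2 : min 1 (min k₀ c₁) ≤ k₀ := (min_le_right _ _).trans (min_le_left _ _)
  have m3 : min 1 (min k₀ c₁) ≤ c₁ := (min_le_right _ _).trans (min_le_right _ _)
  rw [mem_closedBall, dist_eq_norm] at hx
  by_cases hxρ : ‖x - p‖ ≤ ρ
  · have := hin x (by rwa [mem_closedBall, dist_eq_norm])
    nlinarith
  push Not at hxρ
  set G : Set E := {y | ρ ≤ ‖y - p‖ ∧ ‖y - p‖ ≤ R} with hG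
  have hGs : G ⊆ closedBall p R := fun y hy => by
    rw [mem_closedBall, dist_eq_norm]; exact hy.2
  have hn : Continuous fun y : E => ‖y - p‖ := by fun_prop
  have hGc : IsCompact G := by
    refine (isCompact_closedBall p R).of_isClosed_subset ?_ hGs
    exact (isClosed_le continuous_const hn).inter (isClosed_le hn continuous_const)
  have key := H ζ p (Real.exp (-α * R ^ 2)) t G (ball p R) ht hGc (fun y hy => hy)
    (hζ.mono hGs) (hV.mono le_rfl (by nlinarith) le_rfl) ?_ x ⟨hxρ.le, by linarith⟩
  · have : Real.exp (-α * R' ^ 2) ≤ Real.exp (-α * ‖x - p‖ ^ 2) := by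
      apply Real.exp_le_exp.2
      have : ‖x - p‖ ^ 2 ≤ R' ^ 2 := by gcongr
      nlinarith
    have : t * c₁ ≤ t * (Real.exp (-α * ‖x - p‖ ^ 2) - Real.exp (-α * R ^ 2)) := by
      rw [hc₁]; gcongr
    nlinarith
  · rintro y ⟨hy1, hy2⟩
    rcases hy1.lt_or_eq with h1 | h1
    · rcases hy2.lt_or_eq with h2 | h2
      · left
        refine ⟨by rwa [mem_ball, dist_eq_norm], ?_⟩
        have o : IsOpen ({y : E | ρ < ‖y - p‖} ∩ {y : E | ‖y - p‖ < R}) :=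
          (isOpen_lt continuous_const hn).inter (isOpen_lt hn continuous_const)
        exact mem_of_superset (o.mem_nhds ⟨h1, h2⟩) fun w hw => ⟨hw.1.le, hw.2.le⟩
      · right
        rw [h2, sub_self, mul_zero]
        exact hpos y (by rw [mem_closedBall, dist_eq_norm]; exact hy2)
    · right
      have e1 : Real.exp (-α * ‖y - p‖ ^ 2) ≤ 1 := by
        apply Real.exp_le_one_iff.2; nlinarith [sq_nonneg ‖y - p‖]
      have := hin y (by rw [mem_closedBall, dist_eq_norm]; exact h1.ge)
      have := Real.exp_pos (-α * R ^ 2)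
      nlinarith

variable [MeasurableSpace E] [BorelSpace E]

/-- If `z > t` on most of a ball of radius `s`, then `z > θ t` on the ball of radius `2 s`. -/
theorem PucciJetSuper.doubling {C : ℝ} (hC : 0 ≤ C) :
    ∃ m θ : ℝ, 0 < m ∧ 0 < θ ∧ θ ≤ 1 ∧ ∀ (z : E → ℝ) (x : E) (s t K₀ : ℝ), 0 < s → s ≤ 1 →
      0 < t → 0 ≤ K₀ → K₀ ≤ θ * t → ContinuousOn z (closedBall x (3 * s)) →
      (∀ y ∈ closedBall x (3 * s), 0 ≤ z y) → PucciJetSuper C 1 K₀ (ball x (3 * s)) z →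
      μH[(finrank ℝ E : ℝ)] {y ∈ closedBall x s | z y ≤ t} < ENNReal.ofReal (s ^ finrank ℝ E * m) →
      ∀ y ∈ closedBall x (2 * s), θ * t < z y := by
  set μ : Measure E := μH[(finrank ℝ E : ℝ)] with hμ
  have : μ.IsAddHaarMeasure := by rw [hμ]; infer_instance
  obtain ⟨μ₀, hμ₀, HA⟩ := measure_contact (E := E) hC
  obtain ⟨c, hc0, hc1, HB⟩ := PucciJetSuper.growth (E := E) (ρ := 1 / 8) (R' := 2) (R := 3) hC
    (by norm_num) (by norm_num) (by norm_num)
  obtain ⟨m, hm0, hm⟩ : ∃ m : ℝ, 0 < m ∧ ENNReal.ofReal m ≤ μ₀ := by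
    obtain ⟨r, h1, h2⟩ := ENNReal.lt_iff_exists_nnreal_btwn.1 hμ₀
    exact ⟨r, by exact_mod_cast h1, by rw [ENNReal.ofReal_coe_nnreal]; exact h2.le⟩
  refine ⟨m, c / 4, hm0, by positivity, by linarith, ?_⟩
  intro z x s t K₀ hs hs1 ht hK0 hK hz hpos hV hmeas y hy
  set F : E → ℝ := fun w => 2 / t * z (x + s • w) + ⟪(0 : E), w⟫ + 0 with hF
  have hFe : ∀ w, F w = 2 / t * z (x + s • w) := fun w => by simp [hF]
  have hmap : ∀ r : ℝ, ∀ w : E, w ∈ closedBall (0 : E) r → x + s • w ∈ closedBall x (r * s) := by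
    intro r w hw
    rw [mem_closedBall_zero_iff] at hw
    rw [mem_closedBall, dist_eq_norm, add_sub_cancel_left, norm_smul, Real.norm_of_nonneg hs.le]
    nlinarith
  have hFc : ContinuousOn F (closedBall 0 3) := by
    have : ContinuousOn (fun w => 2 / t * z (x + s • w)) (closedBall 0 3) :=
      (hz.comp (by fun_prop : Continuous fun w : E => x + s • w).continuousOn
        (hmap 3)).const_smul (2 / t)
    exact this.congr fun w _ => hFe w
  have hFpos : ∀ w ∈ closedBall (0 : E) 3, 0 ≤ F w := fun w hw => by
    rw [hFe]; have := hpos _ (hmap 3 w hw); positivity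
  have hFV : PucciJetSuper C 1 (c / 2) (ball 0 3) F := by
    refine (hV.comp_affine zero_le_one (s := 2 / t) (r := s) (by positivity) hs x 0 0).mono
      (by linarith) ?_ ?_
    · rw [norm_zero, mul_zero, add_zero]
      have h1 : s ^ 2 ≤ 1 := pow_le_one₀ hs.le hs1
      have h2 : K₀ * (2 / t) ≤ c / 2 := by
        rw [mul_div_assoc', div_le_iff₀ ht]; linarith
      have h3 : 0 ≤ K₀ * (2 / t) := by positivity
      nlinarith
    · intro w hw
      rw [mem_ball_zero_iff] at hw
      rw [mem_ofPred_eq, mem_ball, dist_eq_norm, add_sub_cancel_left, norm_smul,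
        Real.norm_of_nonneg hs.le]
      nlinarith
  have hset : {w ∈ closedBall (0 : E) 1 | F w ≤ 2} =
      (fun w => s • w) ⁻¹' ((fun w => x + w) ⁻¹' {y ∈ closedBall x s | z y ≤ t}) := by
    ext w
    simp only [mem_ofPred_eq, mem_preimage, mem_closedBall, dist_eq_norm, sub_zero,
      add_sub_cancel_left, norm_smul, Real.norm_of_nonneg hs.le, hFe]
    refine and_congr ?_ ?_
    · constructor <;> intro h <;> nlinarith
    · rw [div_mul_eq_mul_div, div_le_iff₀ ht]
      constructor <;> intro h <;> linarith
  have hlt : μ {w ∈ closedBall (0 : E) 1 | F w ≤ 2} < μ₀ := by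
    refine lt_of_lt_of_le ?_ hm
    rw [hset, Measure.addHaar_preimage_smul μ hs.ne', measure_preimage_add,
      abs_of_pos (by positivity)]
    calc _ < ENNReal.ofReal ((s ^ finrank ℝ E)⁻¹) * ENNReal.ofReal (s ^ finrank ℝ E * m) := by
          refine (ENNReal.mul_lt_mul_iff_right ?_ ENNReal.ofReal_ne_top).2 hmeas
          exact (ENNReal.ofReal_pos.2 (by positivity)).ne'
      _ = _ := by
          rw [← ENNReal.ofReal_mul (by positivity), inv_mul_cancel_left₀ (by positivity)]
  have hF1 : ∀ w ∈ closedBall (0 : E) (1 / 8), 1 ≤ F w := by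
    intro w hw
    by_contra! hcon
    refine absurd hlt (not_lt.2 (HA F (hFc.mono (closedBall_subset_closedBall (by norm_num)))
      (fun w hw => hFpos w (closedBall_subset_closedBall (by norm_num) hw))
      (hFV.mono le_rfl (by linarith) (ball_subset_ball (by norm_num))) ⟨w, hw, hcon.le⟩))
  have := HB F 0 1 (c / 2) one_pos (by linarith) hFc hFpos hFV hF1 (s⁻¹ • (y - x)) (by
    rw [mem_closedBall, dist_eq_norm] at hy
    rw [mem_closedBall_zero_iff, norm_smul, norm_inv, Real.norm_of_nonneg hs.le,
      inv_mul_le_iff₀ hs]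
    linarith)
  rw [hFe, smul_smul, mul_inv_cancel₀ hs.ne', one_smul, add_sub_cancel, div_mul_eq_mul_div,
    le_div_iff₀ ht] at this
  nlinarith

/-- A covering step: most of the set where `z > t` expands into the set where `z > t'`. -/
theorem measure_superlevel_le {z : E → ℝ} {p : E} {t t' m : ℝ} (hm : 0 < m)
    (hz : ContinuousOn z (closedBall p (7 / 8)))
    (h : ∀ x ∈ ball p (1 / 8), t < z x → ∃ r : ℝ, 0 < r ∧ r ≤ 1 / 32 ∧
      (∀ y ∈ closedBall x r, t' < z y) ∧
      ENNReal.ofReal (r ^ finrank ℝ E * m) ≤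
        μH[(finrank ℝ E : ℝ)] {y ∈ closedBall x r | z y ≤ t}) :
    μH[(finrank ℝ E : ℝ)] {x ∈ ball p (1 / 8) | t < z x} ≤
      ENNReal.ofReal (5 ^ finrank ℝ E / m) * μH[(finrank ℝ E : ℝ)] (closedBall (0 : E) 1) *
        μH[(finrank ℝ E : ℝ)] {x ∈ closedBall p (7 / 8) | t' < z x ∧ z x ≤ t} := by
  set μ : Measure E := μH[(finrank ℝ E : ℝ)] with hμ
  have : μ.IsAddHaarMeasure := by rw [hμ]; infer_instance
  set S := {x ∈ ball p (1 / 8) | t < z x} with hS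
  have h' : ∀ x : E, ∃ r : ℝ, x ∈ S → 0 < r ∧ r ≤ 1 / 32 ∧
      (∀ y ∈ closedBall x r, t' < z y) ∧
      ENNReal.ofReal (r ^ finrank ℝ E * m) ≤ μ {y ∈ closedBall x r | z y ≤ t} := by
    intro x
    by_cases hx : x ∈ S
    · obtain ⟨r, hr⟩ := h x hx.1 hx.2
      exact ⟨r, fun _ => hr⟩
    · exact ⟨0, fun hx' => absurd hx' hx⟩
  choose r hr using h'
  obtain ⟨U, hUS, hdis, hcov⟩ := Vitali.exists_disjoint_subfamily_covering_enlargement_closedBall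
    S id r (1 / 32) (fun x hx => (hr x hx).2.1) 5 (by norm_num)
  have hUc : U.Countable := by
    refine hdis.countable_of_nonempty_interior fun x hx => ?_
    exact ⟨x, ball_subset_interior_closedBall (mem_ball_self (hr x (hUS hx)).1)⟩
  have hN : IsClosed {y ∈ closedBall p (7 / 8) | z y ≤ t} :=
    isClosed_closedBall.isClosed_le hz continuousOn_const
  have hsub : ∀ x ∈ U, closedBall x (r x) ⊆ closedBall p (7 / 8) := fun x hx => by
    have h1 := (hUS hx).1
    have h2 := (hr x (hUS hx)).2.1
    rw [mem_ball] at h1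
    exact closedBall_subset_closedBall' (by linarith)
  set A : E → Set E := fun x => closedBall x (r x) ∩ {y ∈ closedBall p (7 / 8) | z y ≤ t} with hA
  have hAe : ∀ x ∈ U, {y ∈ closedBall x (r x) | z y ≤ t} = A x := fun x hx => by
    ext y
    constructor
    · rintro ⟨h1, h2⟩; exact ⟨h1, hsub x hx h1, h2⟩
    · rintro ⟨h1, -, h2⟩; exact ⟨h1, h2⟩
  calc μ S ≤ μ (⋃ x ∈ U, closedBall x (5 * r x)) := by
        refine measure_mono fun x hx => ?_
        obtain ⟨b, hb, hb'⟩ := hcov x hx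
        exact mem_biUnion hb (hb' (mem_closedBall_self (hr x hx).1.le))
    _ ≤ ∑' x : U, μ (closedBall (x : E) (5 * r x)) := measure_biUnion_le μ hUc _
    _ ≤ ∑' x : U, ENNReal.ofReal (5 ^ finrank ℝ E / m) * μ (closedBall (0 : E) 1) * μ (A x) := by
        refine ENNReal.tsum_le_tsum fun x => ?_
        obtain ⟨h1, h2, h3, h4⟩ := hr x (hUS x.2)
        rw [hAe x x.2] at h4
        rw [Measure.addHaar_closedBall μ _ (by positivity)]
        have : ENNReal.ofReal ((5 * r x) ^ finrank ℝ E) =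
            ENNReal.ofReal (5 ^ finrank ℝ E / m) * ENNReal.ofReal (r x ^ finrank ℝ E * m) := by
          rw [← ENNReal.ofReal_mul (by positivity), mul_pow]
          congr 1; field_simp
        rw [this, Measure.addHaar_unitClosedBall_eq_addHaar_unitBall, mul_assoc, mul_assoc,
          mul_comm (ENNReal.ofReal (r x ^ finrank ℝ E * m))]
        gcongr
    _ = ENNReal.ofReal (5 ^ finrank ℝ E / m) * μ (closedBall (0 : E) 1) * ∑' x : U, μ (A x) :=
        ENNReal.tsum_mul_left
    _ = ENNReal.ofReal (5 ^ finrank ℝ E / m) * μ (closedBall (0 : E) 1) * μ (⋃ x ∈ U, A x) := by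
        rw [measure_biUnion hUc]
        · exact hdis.mono_on fun x _ => inter_subset_left
        · exact fun x _ => (isClosed_closedBall.inter hN).measurableSet
    _ ≤ _ := by
        gcongr
        refine iUnion₂_subset fun x hx => ?_
        rintro y ⟨h1, h2⟩
        exact ⟨h2.1, (hr x (hUS hx)).2.2.1 y h1, h2.2⟩

end InkSpots

section Concentration

open MeasureTheory Module
open scoped RealInnerProductSpace

variable {E : Type*} [NormedAddCommGroup E] [InnerProductSpace ℝ E] [FiniteDimensional ℝ E]
  [MeasurableSpace E] [BorelSpace E]

/-- A nonnegative supersolution which is small somewhere is small on most of a ball. -/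
theorem PucciJetSuper.measure_superlevel_le {C τ : ℝ} (hC : 0 ≤ C) (hτ : 0 < τ) {ω : ENNReal}
    (hω : 0 < ω) :
    ∃ κ : ℝ, 0 < κ ∧ ∀ (z : E → ℝ) (p : E), ContinuousOn z (closedBall p (7 / 8)) →
      (∀ x ∈ closedBall p (7 / 8), 0 ≤ z x) → PucciJetSuper C 1 κ (ball p (7 / 8)) z →
      (∃ x ∈ closedBall p (1 / 4), z x < κ) →
      μH[(finrank ℝ E : ℝ)] {x ∈ ball p (1 / 8) | τ < z x} ≤ ω := by
  set μ : Measure E := μH[(finrank ℝ E : ℝ)] with hμ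
  have : μ.IsAddHaarMeasure := by rw [hμ]; infer_instance
  obtain ⟨m, θ, hm, hθ, hθ1, HD⟩ := PucciJetSuper.doubling (E := E) hC
  obtain ⟨c, hc, hc1, HG⟩ := PucciJetSuper.growth (E := E) (ρ := 1 / 16) (R' := 1 / 2)
    (R := 5 / 8) hC (by norm_num) (by norm_num) (by norm_num)
  set b := μ (closedBall (0 : E) 1) with hb
  have hbt : b ≠ ⊤ := measure_closedBall_lt_top.ne
  set A := ENNReal.ofReal (5 ^ finrank ℝ E / m) * b with hA
  have hAt : A * b ≠ ⊤ := by finiteness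
  obtain ⟨J, hJ⟩ : ∃ J : ℕ, A * b ≤ J * ω := by
    by_cases hωt : ω = ⊤
    · exact ⟨1, by simp [hωt]⟩
    · obtain ⟨J, hJ⟩ := ENNReal.exists_nat_mul_gt hω.ne' hAt
      exact ⟨J, hJ.le⟩
  have hJ' : A * b ≤ (J + 1 : ℕ) * ω := hJ.trans (by gcongr; simp)
  set κ := c * (θ * (τ * θ ^ J)) with hκ
  refine ⟨κ, by positivity, ?_⟩
  rintro z p hz hpos hV ⟨x₀, hx₀, hxκ⟩
  set t : ℕ → ℝ := fun j => τ * θ ^ j with ht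
  have ht0 : ∀ j, 0 < t j := fun j => by simp only [ht]; positivity
  have htanti : Antitone t := fun i j hij => by
    simp only [ht]
    exact mul_le_mul_of_nonneg_left (pow_le_pow_of_le_one hθ.le hθ1 hij) hτ.le
  have hκt : ∀ j ≤ J, κ ≤ c * (θ * t j) := fun j hj => by
    have := htanti hj; simp only [hκ]; gcongr
  have hκθ : ∀ j ≤ J, κ ≤ θ * t j := fun j hj =>
    (hκt j hj).trans (mul_le_of_le_one_left (by have := ht0 j; positivity) hc1)
  have hκ0 : 0 < κ := by positivity
  have step : ∀ j ≤ J, μ {x ∈ ball p (1 / 8) | t j < z x} ≤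
      A * μ {x ∈ closedBall p (7 / 8) | t (j + 1) < z x ∧ z x ≤ t j} := by
    intro j hj
    refine _root_.measure_superlevel_le hm hz ?_
    intro x hx hxt
    rw [mem_ball] at hx
    set s : ℕ → ℝ := fun i => 1 / 32 * (1 / 2) ^ i with hs
    have hs0 : ∀ i, 0 < s i := fun i => by simp only [hs]; positivity
    have hs1 : ∀ i, s i ≤ 1 / 32 := fun i => by
      have : (1 / 2 : ℝ) ^ i ≤ 1 := pow_le_one₀ (by norm_num) (by norm_num)
      simp only [hs]; linarith
    set good : ℕ → Prop := fun i =>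
      μ {y ∈ closedBall x (s i) | z y ≤ t j} < ENNReal.ofReal (s i ^ finrank ℝ E * m) with hgood
    have hin : ∀ i, closedBall x (3 * s i) ⊆ closedBall p (7 / 8) := fun i =>
      closedBall_subset_closedBall' (by have := hs1 i; linarith)
    have hin' : ∀ i, ball x (3 * s i) ⊆ ball p (7 / 8) := fun i =>
      ball_subset_ball' (by have := hs1 i; linarith)
    have hdb : ∀ i, good i → ∀ y ∈ closedBall x (2 * s i), t (j + 1) < z y := by
      intro i hi
      have := HD z x (s i) (t j) κ (hs0 i) ((hs1 i).trans (by norm_num)) (ht0 j) hκ0.le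
        (hκθ j hj) (hz.mono (hin i)) (fun y hy => hpos y (hin i hy))
        (hV.mono le_rfl le_rfl (hin' i)) hi
      have e : t (j + 1) = θ * t j := by simp only [ht]; ring
      rwa [e]
    have h0 : ¬ good 0 := by
      intro h
      have h1 := hdb 0 h
      have e : 2 * s 0 = 1 / 16 := by simp only [hs]; norm_num
      rw [e] at h1
      have e : t (j + 1) = θ * t j := by simp only [ht]; ring
      have hsub : closedBall x (5 / 8) ⊆ closedBall p (7 / 8) :=
        closedBall_subset_closedBall' (by linarith)
      have hsub' : ball x (5 / 8) ⊆ ball p (7 / 8) := ball_subset_ball' (by linarith)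
      have := HG z x (θ * t j) κ (by have := ht0 j; positivity) (hκt j hj) (hz.mono hsub)
        (fun y hy => hpos y (hsub hy)) (hV.mono le_rfl le_rfl hsub')
        (fun y hy => by rw [← e]; exact (h1 y hy).le) x₀
        (closedBall_subset_closedBall' (by rw [dist_comm]; linarith) hx₀)
      linarith [hκt j hj]
    have hex : ∃ i, good i := by
      have hxn : closedBall p (7 / 8) ∈ 𝓝 x :=
        mem_of_superset (isOpen_ball.mem_nhds (by rw [mem_ball]; linarith : x ∈ ball p (7 / 8)))
          ball_subset_closedBall
      have hev : ∀ᶠ y in 𝓝 x, t j < z y :=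
        (hz.continuousAt hxn).eventually_const_lt hxt
      obtain ⟨ε, hε, hball⟩ := Metric.eventually_nhds_iff.1 hev
      obtain ⟨i, hi⟩ := exists_pow_lt_of_lt_one hε (by norm_num : (1 / 2 : ℝ) < 1)
      refine ⟨i, ?_⟩
      have : {y ∈ closedBall x (s i) | z y ≤ t j} = ∅ := by
        ext y
        simp only [mem_ofPred_eq, mem_empty_iff_false, iff_false, not_and, not_le, mem_closedBall]
        intro hy
        refine hball (hy.trans_lt ?_)
        have : (0 : ℝ) < (1 / 2) ^ i := by positivity
        simp only [hs]; linarith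
      simp only [hgood]
      rw [this, measure_empty]
      exact ENNReal.ofReal_pos.2 (by have := hs0 i; positivity)
    classical
    obtain ⟨i, hi⟩ : ∃ i, Nat.find hex = i + 1 := Nat.exists_eq_succ_of_ne_zero fun h =>
      h0 (h ▸ Nat.find_spec hex)
    have hi1 : good (i + 1) := hi ▸ Nat.find_spec hex
    have hi2 : ¬ good i := Nat.find_min hex (by omega)
    refine ⟨s i, hs0 i, hs1 i, ?_, not_lt.1 hi2⟩
    have e : s i = 2 * s (i + 1) := by simp only [hs]; ring
    rw [e]
    exact hdb _ hi1
  set S : ℕ → Set E := fun j => {x ∈ closedBall p (7 / 8) | t (j + 1) < z x ∧ z x ≤ t j} with hS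
  have hmS : ∀ j, MeasurableSet (S j) := by
    intro j
    have hcl : ∀ a, MeasurableSet {x ∈ closedBall p (7 / 8) | z x ≤ a} := fun a =>
      (isClosed_closedBall.isClosed_le hz continuousOn_const).measurableSet
    have : S j = {x ∈ closedBall p (7 / 8) | z x ≤ t j} \
        {x ∈ closedBall p (7 / 8) | z x ≤ t (j + 1)} := by
      ext x
      simp only [hS, mem_ofPred_eq, Set.mem_sdiff, not_and, not_le]
      tauto
    rw [this]
    exact (hcl _).diff (hcl _)
  have hdS : Pairwise (Function.onFun Disjoint S) := by
    have : ∀ i j, i < j → Disjoint (S i) (S j) := by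
      intro i j hij
      rw [Set.disjoint_left]
      rintro x ⟨-, h1, -⟩ ⟨-, -, h2⟩
      exact absurd (h1.trans_le (h2.trans (htanti hij))) (lt_irrefl _)
    intro i j hij
    rcases hij.lt_or_gt with h | h
    · exact this i j h
    · exact (this j i h).symm
  have hsum : ∑ j ∈ Finset.range (J + 1), μ (S j) ≤ b := by
    rw [← measure_biUnion_finset (fun i _ j _ h => hdS h) (fun j _ => hmS j)]
    calc _ ≤ μ (closedBall p 1) := measure_mono (iUnion₂_subset fun j _ x hx =>
          closedBall_subset_closedBall (by norm_num) hx.1)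
      _ = b := by rw [hb, Measure.addHaar_closedBall_center]
  have hmul : (J + 1 : ℕ) * μ {x ∈ ball p (1 / 8) | τ < z x} ≤ (J + 1 : ℕ) * ω := by
    calc (J + 1 : ℕ) * μ {x ∈ ball p (1 / 8) | τ < z x}
        = ∑ j ∈ Finset.range (J + 1), μ {x ∈ ball p (1 / 8) | τ < z x} := by simp
      _ ≤ ∑ j ∈ Finset.range (J + 1), A * μ (S j) := by
          refine Finset.sum_le_sum fun j hj => le_trans ?_ (step j ?_)
          · refine measure_mono fun x hx => ⟨hx.1, lt_of_le_of_lt ?_ hx.2⟩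
            have := htanti (Nat.zero_le j)
            simpa [ht] using this
          · have := Finset.mem_range.1 hj; omega
      _ = A * ∑ j ∈ Finset.range (J + 1), μ (S j) := by rw [Finset.mul_sum]
      _ ≤ A * b := by gcongr
      _ ≤ _ := hJ'
  exact (ENNReal.mul_le_mul_iff_right (by simp) (by simp)).1 hmul

end Concentration

section Slopes

open MeasureTheory Module
open scoped RealInnerProductSpace

variable {E : Type*} [NormedAddCommGroup E] [InnerProductSpace ℝ E]

/-- `z(x) ≥ m ⟪ν, x⟫ - o(|x|)` in the half-space `⟪ν, x⟫ ≥ 0`. -/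
def LowSlope (ν : E) (z : E → ℝ) (m : ℝ) : Prop :=
  ∀ ε > 0, ∀ᶠ x in 𝓝 (0 : E), 0 ≤ ⟪ν, x⟫ → m * ⟪ν, x⟫ - ε * ‖x‖ ≤ z x

/-- `z` is a continuous supersolution in a half-ball, bounded below quadratically on the flat
part of the boundary. -/
structure HalfBallSuper (C K₁ K₀ B r : ℝ) (ν : E) (z : E → ℝ) : Prop where
  cont : ContinuousOn z {x | x ∈ closedBall 0 r ∧ 0 ≤ ⟪ν, x⟫}
  jet : PucciJetSuper C K₁ K₀ {x | x ∈ ball 0 r ∧ 0 < ⟪ν, x⟫} z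
  flat : ∀ x ∈ closedBall (0 : E) r, ⟪ν, x⟫ = 0 → -B * ‖x‖ ^ 2 ≤ z x

theorem inner_le_norm_of_unit {ν : E} (hν : ‖ν‖ = 1) (x : E) : ⟪ν, x⟫ ≤ ‖x‖ := by
  simpa [hν] using real_inner_le_norm ν x

theorem abs_inner_le_norm_of_unit {ν : E} (hν : ‖ν‖ = 1) (x : E) : |⟪ν, x⟫| ≤ ‖x‖ := by
  simpa [hν] using abs_real_inner_le_norm ν x

theorem LowSlope.add_inner {ν : E} {z : E → ℝ} {m : ℝ} (h : LowSlope ν z m) (a : ℝ) :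
    LowSlope ν (fun x => z x + a * ⟪ν, x⟫) (m + a) := by
  intro ε hε
  filter_upwards [h ε hε] with x hx h0
  linarith [hx h0]

theorem isGreatest_lowSlope_add {ν : E} {z : E → ℝ} {m : ℝ}
    (h : IsGreatest {m | LowSlope ν z m} m) (a : ℝ) :
    IsGreatest {m | LowSlope ν (fun x => z x + a * ⟪ν, x⟫) m} (m + a) := by
  refine ⟨LowSlope.add_inner h.1 a, fun m' hm' => ?_⟩
  have h1 := LowSlope.add_inner hm' (-a)
  have : LowSlope ν z (m' + -a) := by
    intro ε hε
    filter_upwards [h1 ε hε] with x hx h0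
    linarith [hx h0]
  linarith [h.2 this]

theorem LowSlope.add_neg_nonpos {ν : E} (hν : ‖ν‖ = 1) {z : E → ℝ} {m m' : ℝ}
    (h : LowSlope ν z m) (h' : LowSlope ν (fun x => -z x) m') : m + m' ≤ 0 := by
  by_contra! hcon
  set ε := (m + m') / 4 with hε
  have hε0 : 0 < ε := by positivity
  have ht : Tendsto (fun t : ℝ => t • ν) (𝓝[>] 0) (𝓝 0) := by
    have : Continuous fun t : ℝ => t • ν := by fun_prop
    simpa using (this.tendsto 0).mono_left nhdsWithin_le_nhds
  obtain ⟨t, h1, h2, h3⟩ := ((ht.eventually (h ε hε0)).and ((ht.eventually (h' ε hε0)).and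
    self_mem_nhdsWithin)).exists
  have ht0 : 0 < t := h3
  have e : ⟪ν, t • ν⟫ = t := by rw [inner_smul_right, real_inner_self_eq_norm_sq, hν]; ring
  have n : ‖t • ν‖ = t := by rw [norm_smul, hν, Real.norm_of_nonneg ht0.le, mul_one]
  rw [e, n] at h1 h2
  have a1 := h1 ht0.le
  have a2 := h2 ht0.le
  nlinarith

theorem exists_isGreatest_lowSlope {ν : E} (hν : ‖ν‖ = 1) {z : E → ℝ} {m m' : ℝ}
    (h : LowSlope ν z m) (h' : LowSlope ν (fun x => -z x) m') :
    ∃ M, IsGreatest {m | LowSlope ν z m} M := by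
  have hb : BddAbove {m | LowSlope ν z m} := ⟨-m', fun a ha => by
    linarith [LowSlope.add_neg_nonpos hν ha h']⟩
  refine ⟨sSup {m | LowSlope ν z m}, ?_, fun a ha => le_csSup hb ha⟩
  intro ε hε
  obtain ⟨a, ha, hal⟩ := exists_lt_of_lt_csSup ⟨m, h⟩
    (by linarith : sSup {m | LowSlope ν z m} - ε / 2 < sSup {m | LowSlope ν z m})
  filter_upwards [ha (ε / 2) (by positivity)] with x hx h0
  have h1 := hx h0
  have h2 := inner_le_norm_of_unit hν x
  nlinarith

theorem quadratic_expand (ν w y : E) (a b c : ℝ) :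
    a * ⟪ν, y⟫ - b * ‖y‖ ^ 2 + c ^ 2 * ⟪ν, y⟫ ^ 2 =
      (a * ⟪ν, w⟫ - b * ‖w‖ ^ 2 + c ^ 2 * ⟪ν, w⟫ ^ 2) +
        ⟪a • ν - (2 * b) • w + (2 * c ^ 2 * ⟪ν, w⟫) • ν, y - w⟫ + ⟪c • ν, y - w⟫ ^ 2
        - b * ‖y - w‖ ^ 2 := by
  have e : y = w + (y - w) := by abel
  generalize y - w = D at *
  subst e
  rw [norm_add_sq_real]
  simp only [inner_add_left, inner_sub_left, inner_add_right, inner_smul_left, RCLike.conj_to_real]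
  ring

theorem halfBall_mem_nhds {ν w : E} {r : ℝ} (h1 : ‖w‖ < r) (h2 : 0 < ⟪ν, w⟫) :
    {x : E | x ∈ closedBall 0 r ∧ 0 ≤ ⟪ν, x⟫} ∈ 𝓝 w := by
  have o : IsOpen {x : E | 0 < ⟪ν, x⟫} :=
    isOpen_lt continuous_const (by fun_prop : Continuous fun x : E => ⟪ν, x⟫)
  filter_upwards [isOpen_ball.mem_nhds (mem_ball_zero_iff.2 h1), o.mem_nhds h2] with x hx hx'
  exact ⟨ball_subset_closedBall hx, le_of_lt hx'⟩

variable [FiniteDimensional ℝ E]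

theorem isCompact_halfBall (ν : E) (r : ℝ) :
    IsCompact {x : E | x ∈ closedBall 0 r ∧ 0 ≤ ⟪ν, x⟫} :=
  (isCompact_closedBall (0 : E) r).inter_right
    (isClosed_le continuous_const (by fun_prop : Continuous fun x : E => ⟪ν, x⟫))

/-- Linear lower bound at a flat boundary point. -/
theorem HalfBallSuper.exists_lowSlope {C K₁ K₀ B r : ℝ} {ν : E} {z : E → ℝ} (hν : ‖ν‖ = 1)
    (hC : 0 ≤ C) (hK₁ : 0 ≤ K₁) (hK₀ : 0 ≤ K₀) (hB : 0 ≤ B) (hr : 0 < r)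
    (h : HalfBallSuper C K₁ K₀ B r ν z) : ∃ m, LowSlope ν z m := by
  obtain ⟨Mz, hMz⟩ := (isCompact_halfBall ν r).exists_bound_of_continuousOn h.cont
  have hMz0 : 0 ≤ Mz := (norm_nonneg _).trans (hMz 0 ⟨by simp [hr.le], by simp⟩)
  set ρ := min r (1 / (8 * K₁ + 8)) with hρ
  have hρ0 : 0 < ρ := lt_min hr (by positivity)
  have hρr : ρ ≤ r := min_le_left _ _
  have hρK : K₁ * ρ ≤ 1 / 8 := by
    have : ρ ≤ 1 / (8 * K₁ + 8) := min_le_right _ _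
    rw [le_div_iff₀ (by positivity)] at this
    nlinarith
  set b := B + Mz / ρ ^ 2 with hb
  have hb0 : 0 ≤ b := by positivity
  have hbB : B ≤ b := by have : 0 ≤ Mz / ρ ^ 2 := by positivity
                         linarith
  have hbM : Mz ≤ b * ρ ^ 2 := by
    have : Mz / ρ ^ 2 * ρ ^ 2 = Mz := by field_simp
    have : 0 ≤ B * ρ ^ 2 := by positivity
    rw [hb, add_mul]; linarith
  set A := 2 * (C * b + K₀ + b + 1) with hA
  have hA0 : 0 < A := by positivity
  set m := A * ρ with hm
  set φ : E → ℝ := fun x => -m * ⟪ν, x⟫ - b * ‖x‖ ^ 2 + √A ^ 2 * ⟪ν, x⟫ ^ 2 with hφ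
  have hsA : √A ^ 2 = A := Real.sq_sqrt hA0.le
  set G : Set E := {x | x ∈ closedBall 0 ρ ∧ 0 ≤ ⟪ν, x⟫} with hG
  have hGr : G ⊆ {x | x ∈ closedBall 0 r ∧ 0 ≤ ⟪ν, x⟫} := fun x hx =>
    ⟨closedBall_subset_closedBall hρr hx.1, hx.2⟩
  have hφc : Continuous φ := by fun_prop
  have h0G : (0 : E) ∈ G := ⟨by simp [hρ0.le], by simp⟩
  obtain ⟨w, hwG, hw⟩ := (isCompact_halfBall ν ρ).exists_isMinOn ⟨0, h0G⟩
    ((h.cont.mono hGr).sub hφc.continuousOn)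
  have hwm : ∀ y ∈ G, z w - φ w ≤ z y - φ y := fun y hy => hw hy
  have key : 0 ≤ z w - φ w := by
    have hwn := hwG.1
    rw [mem_closedBall_zero_iff] at hwn
    rcases hwG.2.eq_or_lt with h1 | h1
    · have h2 := h.flat w (hGr hwG).1 h1.symm
      have : B * ‖w‖ ^ 2 ≤ b * ‖w‖ ^ 2 := by gcongr
      simp only [hφ, ← h1]; linarith
    rcases hwn.eq_or_lt with h2 | h2
    · have h3 := hMz w (hGr hwG)
      rw [Real.norm_eq_abs] at h3
      have h4 := (abs_le.1 h3).1
      have h5 := inner_le_norm_of_unit hν w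
      have : A * ⟪ν, w⟫ * ⟪ν, w⟫ ≤ A * ⟪ν, w⟫ * ρ :=
        mul_le_mul_of_nonneg_left (by linarith) (by positivity)
      simp only [hφ, hsA, h2, hm]
      nlinarith
    exfalso
    have := h.jet.of_isMinOn (φ := φ) (x := w) ⟨mem_ball_zero_iff.2 (by linarith), h1⟩
      (halfBall_mem_nhds h2 h1) hwm (g := (-m) • ν - (2 * b) • w + (2 * √A ^ 2 * ⟪ν, w⟫) • ν)
      (e := √A • ν) (γ := b) hb0 (Eventually.of_forall fun y => (by
        simp only [hφ]
        exact (quadratic_expand ν w y (-m) b (√A)).ge))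
    have hg : ‖(-m) • ν - (2 * b) • w + (2 * √A ^ 2 * ⟪ν, w⟫) • ν‖ ≤
        3 * A * ρ + 2 * b * ρ := by
      refine (norm_add_le _ _).trans ?_
      have i1 := norm_sub_le ((-m) • ν) ((2 * b) • w)
      rw [norm_smul, norm_smul, hν, norm_neg, Real.norm_of_nonneg (by positivity),
        Real.norm_of_nonneg (by positivity)] at i1
      rw [norm_smul, hν, hsA, Real.norm_of_nonneg (by positivity)]
      have i2 := inner_le_norm_of_unit hν w
      have i3 : 2 * A * ⟪ν, w⟫ ≤ 2 * A * ρ := by gcongr; linarith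
      have i4 : 2 * b * ‖w‖ ≤ 2 * b * ρ := by gcongr
      rw [hm] at i1 ⊢
      linarith
    have i1 := mul_le_mul_of_nonneg_left hg hK₁
    rw [hsA] at i1
    rw [norm_smul, hν, mul_one, Real.norm_of_nonneg (by positivity), hsA] at this
    have i2 : K₁ * (3 * A * ρ + 2 * b * ρ) = K₁ * ρ * (3 * A + 2 * b) := by ring
    have i3 : K₁ * ρ * (3 * A + 2 * b) ≤ 1 / 8 * (3 * A + 2 * b) := by gcongr
    linarith
  refine ⟨-m, fun ε hε => ?_⟩
  have c1 : ∀ᶠ x : E in 𝓝 0, ‖x‖ < ρ :=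
    continuous_norm.continuousAt.eventually_lt_const (by simpa using hρ0)
  have c2 : ∀ᶠ x : E in 𝓝 0, b * ‖x‖ < ε := by
    have : Continuous fun x : E => b * ‖x‖ := by fun_prop
    exact this.continuousAt.eventually_lt_const (by simpa using hε)
  filter_upwards [c1, c2] with x h1 h2 h3
  have h4 := key.trans (hwm x ⟨mem_closedBall_zero_iff.2 h1.le, h3⟩)
  simp only [hφ, hsA] at h4
  have : 0 ≤ A * ⟪ν, x⟫ ^ 2 := by positivity
  nlinarith [norm_nonneg x]

end Slopes

section BoundaryHarnack

open MeasureTheory Module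
open scoped RealInnerProductSpace

theorem eventually_mul_lt (K : ℝ) {c : ℝ} (hc : 0 < c) : ∀ᶠ s in 𝓝[>] (0 : ℝ), K * s < c := by
  have : Continuous fun s : ℝ => K * s := by fun_prop
  exact (this.continuousAt.eventually_lt_const (by simpa using hc)).filter_mono nhdsWithin_le_nhds

variable {E : Type*} [NormedAddCommGroup E] [InnerProductSpace ℝ E]

theorem PucciJetSuper.blowup {C K₁ K₀ r s : ℝ} {ν : E} {z : E → ℝ} (hK₁ : 0 ≤ K₁) (hs : 0 < s)
    (h : PucciJetSuper C K₁ K₀ {x | x ∈ ball 0 r ∧ 0 < ⟪ν, x⟫} z) (c : ℝ) :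
    PucciJetSuper C (K₁ * s) (K₀ * s) {x | s * ‖x‖ < r ∧ 0 < ⟪ν, x⟫}
      (fun x => s⁻¹ * z (s • x) + c) := by
  have := (h.comp_affine hK₁ (inv_pos.2 hs) hs 0 0 c).mono (V' := {x | s * ‖x‖ < r ∧ 0 < ⟪ν, x⟫})
    (K₀' := K₀ * s) le_rfl ?_ ?_
  · simpa only [zero_add, inner_zero_left, add_zero] using this
  · rw [norm_zero, mul_zero, add_zero, pow_two]; field_simp; rfl
  · rintro x ⟨h1, h2⟩
    refine ⟨?_, ?_⟩
    · rwa [mem_ball_zero_iff, zero_add, norm_smul, Real.norm_of_nonneg hs.le]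
    · rw [zero_add, inner_smul_right]; positivity

theorem HalfBallSuper.continuousOn_blowup {C K₁ K₀ B r s : ℝ} {ν : E} {z : E → ℝ}
    (h : HalfBallSuper C K₁ K₀ B r ν z) (hs : 0 < s) (c : ℝ) :
    ContinuousOn (fun x => s⁻¹ * z (s • x) + c) {x | s * ‖x‖ ≤ r ∧ 0 ≤ ⟪ν, x⟫} := by
  refine ContinuousOn.add (ContinuousOn.mul continuousOn_const ?_) continuousOn_const
  refine h.cont.comp (by fun_prop : Continuous fun x : E => s • x).continuousOn ?_
  rintro x ⟨h1, h2⟩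
  refine ⟨?_, ?_⟩
  · rwa [mem_closedBall_zero_iff, norm_smul, Real.norm_of_nonneg hs.le]
  · rw [inner_smul_right]; positivity

theorem norm_sub_unit_sq {ν : E} (hν : ‖ν‖ = 1) (x : E) :
    ‖x - ν‖ ^ 2 = 1 - 2 * ⟪ν, x⟫ + ‖x‖ ^ 2 := by
  rw [norm_sub_sq_real, hν, real_inner_comm]; ring

theorem inner_pos_of_mem_closedBall {ν x : E} (hν : ‖ν‖ = 1) {ρ : ℝ}
    (hx : x ∈ closedBall ν ρ) : 1 - ρ ≤ ⟪ν, x⟫ := by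
  rw [mem_closedBall, dist_eq_norm] at hx
  have h1 := abs_inner_le_norm_of_unit hν (x - ν)
  rw [inner_sub_right, real_inner_self_eq_norm_sq, hν] at h1
  have := (abs_le.1 h1).1
  linarith

theorem HalfBallSuper.add_inner {C K₁ K₀ B r : ℝ} {ν : E} {z : E → ℝ} (hν : ‖ν‖ = 1)
    (hK₁ : 0 ≤ K₁) (h : HalfBallSuper C K₁ K₀ B r ν z) (a : ℝ) :
    HalfBallSuper C K₁ (K₀ + K₁ * |a|) B r ν (fun x => z x + a * ⟪ν, x⟫) where
  cont := h.cont.add (by fun_prop)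
  jet := by
    have := (h.jet.comp_affine hK₁ one_pos one_pos 0 (a • ν) 0)
    simpa [norm_smul, hν, inner_smul_left] using this
  flat x hx h0 := by simpa [h0] using h.flat x hx h0

variable [FiniteDimensional ℝ E] [MeasurableSpace E] [BorelSpace E]

set_option maxHeartbeats 1000000 in
/-- If the maximal slope of `z` is zero, then the blow-ups of `z` are small on most of a ball. -/
theorem HalfBallSuper.measure_blowup_le {C K₁ K₀ B r : ℝ} {ν : E} {z : E → ℝ} (hν : ‖ν‖ = 1)
    (hC : 0 ≤ C) (hK₁ : 0 ≤ K₁) (hr : 0 < r)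
    (h : HalfBallSuper C K₁ K₀ B r ν z) (hm : IsGreatest {m | LowSlope ν z m} 0)
    {τ : ℝ} (hτ : 0 < τ) {ω : ENNReal} (hω : 0 < ω) :
    ∀ᶠ s in 𝓝[>] (0 : ℝ),
      μH[(finrank ℝ E : ℝ)] {x ∈ ball ν (1 / 8) | τ < s⁻¹ * z (s • x)} ≤ ω := by
  obtain ⟨κ, hκ, HM⟩ := PucciJetSuper.measure_superlevel_le (E := E) hC hτ hω
  obtain ⟨α, k₀, hα, hk₀, HE⟩ := exp_barrier (E := E) (ρ := 1 / 4) (R := 2) hC (by norm_num)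
    (by norm_num)
  set a := Real.exp (-α) with ha
  have ha0 : 0 < a := Real.exp_pos _
  have ha4 : Real.exp (-α * 2 ^ 2) < a := Real.exp_lt_exp.2 (by linarith)
  have hα0 : 0 < α := by linarith
  set ε := min (κ / 2 * (a - Real.exp (-α * 2 ^ 2))) (κ / 2) with hε
  have hε0 : 0 < ε := lt_min (mul_pos (by positivity) (by linarith)) (by positivity)
  obtain ⟨δ, hδ, hlow⟩ := Metric.eventually_nhds_iff.1 (hm.1 (ε / 3) (by positivity))
  filter_upwards [eventually_mul_lt 3 hδ, eventually_mul_lt 3 hr, eventually_mul_lt K₁ one_pos,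
    eventually_mul_lt K₀ hκ, eventually_mul_lt K₀ (by positivity : 0 < κ / 2 * k₀),
    eventually_mul_lt B (by positivity : 0 < κ / 2 * (a * (α / (1 + 9 * α)))),
    self_mem_nhdsWithin] with s s1 s2 s3 s4 s5 s6 s7
  have hs : 0 < s := s7
  set f : E → ℝ := fun x => s⁻¹ * z (s • x) with hf
  have hflow : ∀ x, ‖x‖ ≤ 3 → 0 ≤ ⟪ν, x⟫ → -ε ≤ f x := by
    intro x h1 h2
    have n : ‖s • x‖ = s * ‖x‖ := by rw [norm_smul, Real.norm_of_nonneg hs.le]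
    have := hlow (y := s • x) (by rw [dist_zero_right, n]; nlinarith)
      (by rw [inner_smul_right]; positivity)
    rw [n] at this
    simp only [hf]
    have h3 := mul_le_mul_of_nonneg_left this (inv_pos.2 hs).le
    refine le_trans ?_ h3
    have e : s⁻¹ * (0 * ⟪ν, s • x⟫ - ε / 3 * (s * ‖x‖)) = - (ε / 3 * ‖x‖) := by field_simp; ring
    rw [e]
    nlinarith
  by_cases hcase : ∃ x ∈ closedBall ν (1 / 4), f x + ε < κ
  · have hsub : closedBall ν (7 / 8) ⊆ {x | s * ‖x‖ < r ∧ 0 < ⟪ν, x⟫} := by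
      intro x hx
      have h1 := inner_pos_of_mem_closedBall hν hx
      rw [mem_closedBall, dist_eq_norm] at hx
      have h2 : ‖x‖ ≤ 3 := by have := norm_add_le (x - ν) ν; rw [sub_add_cancel, hν] at this; linarith
      exact ⟨by nlinarith, by linarith⟩
    have hM := HM (fun x => f x + ε) ν
      ((h.continuousOn_blowup hs ε).mono fun x hx => ⟨(hsub hx).1.le, (hsub hx).2.le⟩)
      (fun x hx => by
        have h2 : ‖x‖ ≤ 3 := by
          rw [mem_closedBall, dist_eq_norm] at hx
          have := norm_add_le (x - ν) ν; rw [sub_add_cancel, hν] at this; linarith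
        linarith [hflow x h2 (hsub hx).2.le])
      ((h.jet.blowup hK₁ hs ε).mono s3.le s4.le (ball_subset_closedBall.trans hsub)) hcase
    refine le_trans (measure_mono ?_) hM
    rintro x ⟨hx1, hx2⟩
    refine ⟨hx1, ?_⟩
    simp only [hf]
    linarith
  · exfalso
    push Not at hcase
    set G : Set E := {x | (0 ≤ ⟪ν, x⟫ ∧ 1 / 4 ≤ ‖x - ν‖) ∧ ‖x - ν‖ ≤ 2} with hG
    have hnc : Continuous fun y : E => ‖y - ν‖ := by fun_prop
    have hic : Continuous fun y : E => ⟪ν, y⟫ := by fun_prop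
    have hGc : IsCompact G := by
      refine (isCompact_closedBall ν 2).of_isClosed_subset ?_ fun x hx => by
        rw [mem_closedBall, dist_eq_norm]; exact hx.2
      exact ((isClosed_le continuous_const hic).inter (isClosed_le continuous_const hnc)).inter
        (isClosed_le hnc continuous_const)
    have hG3 : ∀ x ∈ G, ‖x‖ ≤ 3 := fun x hx => by
      have := norm_add_le (x - ν) ν; rw [sub_add_cancel, hν] at this; linarith [hx.2]
    have hsr : ∀ x ∈ G, s * ‖x‖ < r := fun x hx => by have := hG3 x hx; nlinarith
    have hjet := (h.jet.blowup hK₁ hs 0).mono s3.le (s5.le) le_rfl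
    have hcont : ContinuousOn (fun x => s⁻¹ * z (s • x) + 0) G :=
      (h.continuousOn_blowup hs 0).mono fun x hx => ⟨(hsr x hx).le, hx.1.1⟩
    simp only [add_zero] at hjet hcont
    have key := HE f ν a (κ / 2) G _ (by positivity) hGc (fun x hx => ⟨hx.1.2, hx.2⟩)
      hcont hjet ?_
    · have hpos : 0 < κ / 2 * (a * (2 * α)) := by positivity
      have hub : ∀ m, LowSlope ν z m → m ≤ 0 := fun m h => hm.2 h
      refine absurd (hub (κ / 2 * (a * (2 * α))) ?_) (not_le.2 hpos)
      intro ε' hε'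
      have c1 : ∀ᶠ x : E in 𝓝 0, ‖x‖ < s / 4 :=
        continuous_norm.continuousAt.eventually_lt_const (by simpa using by positivity)
      have c2 : ∀ᶠ x : E in 𝓝 0, κ / 2 * (a * α) / s * ‖x‖ < ε' := by
        have : Continuous fun x : E => κ / 2 * (a * α) / s * ‖x‖ := by fun_prop
        exact this.continuousAt.eventually_lt_const (by simpa using hε')
      filter_upwards [c1, c2] with x h1 h2 h3
      have n : ‖s⁻¹ • x‖ = ‖x‖ / s := by
        rw [norm_smul, norm_inv, Real.norm_of_nonneg hs.le]; ring
      have n4 : ‖s⁻¹ • x‖ < 1 / 4 := by rw [n, div_lt_iff₀ hs]; linarith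
      have i0 : ⟪ν, s⁻¹ • x⟫ = ⟪ν, x⟫ / s := by rw [inner_smul_right]; ring
      have d1 := norm_sub_le (s⁻¹ • x) ν
      have d2 := norm_sub_norm_le ν (s⁻¹ • x)
      rw [norm_sub_rev] at d2
      rw [hν] at d1 d2
      have kx := key (s⁻¹ • x) ⟨⟨by rw [i0]; positivity, by linarith⟩, by linarith⟩
      have e1 : a * (1 + α * (2 * (⟪ν, x⟫ / s) - (‖x‖ / s) ^ 2)) ≤
          Real.exp (-α * ‖s⁻¹ • x - ν‖ ^ 2) := by
        rw [norm_sub_unit_sq hν, n, i0]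
        have : -α * (1 - 2 * (⟪ν, x⟫ / s) + (‖x‖ / s) ^ 2) =
          -α + α * (2 * (⟪ν, x⟫ / s) - (‖x‖ / s) ^ 2) := by ring
        rw [this, Real.exp_add]
        refine mul_le_mul_of_nonneg_left ?_ ha0.le
        have := Real.add_one_le_exp (α * (2 * (⟪ν, x⟫ / s) - (‖x‖ / s) ^ 2))
        linarith
      have e2 : κ / 2 * (a * (α * (2 * (⟪ν, x⟫ / s) - (‖x‖ / s) ^ 2))) ≤ s⁻¹ * z x := by
        have : f (s⁻¹ • x) = s⁻¹ * z x := by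
          simp only [hf, smul_smul, mul_inv_cancel₀ hs.ne', one_smul]
        rw [← this]
        refine le_trans (mul_le_mul_of_nonneg_left ?_ (by positivity)) kx
        linarith
      have e3 := mul_le_mul_of_nonneg_left e2 hs.le
      rw [mul_inv_cancel_left₀ hs.ne'] at e3
      refine le_trans ?_ e3
      have e4 : s * (κ / 2 * (a * (α * (2 * (⟪ν, x⟫ / s) - (‖x‖ / s) ^ 2)))) =
          κ / 2 * (a * (2 * α)) * ⟪ν, x⟫ - κ / 2 * (a * α) / s * ‖x‖ * ‖x‖ := by
        field_simp
      rw [e4]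
      have := mul_le_mul_of_nonneg_right h2.le (norm_nonneg x)
      linarith
    · rintro x ⟨⟨x1, x2⟩, x3⟩
      have hxG : x ∈ G := ⟨⟨x1, x2⟩, x3⟩
      rcases x3.eq_or_lt with y3 | y3
      · right
        rw [y3]
        have : ε ≤ κ / 2 * (a - Real.exp (-α * 2 ^ 2)) := min_le_left _ _
        linarith [hflow x (hG3 x hxG) x1]
      rcases x2.eq_or_lt with y2 | y2
      · right
        have h1 := hcase x (by rw [mem_closedBall, dist_eq_norm]; exact y2.ge)
        have : ε ≤ κ / 2 := min_le_right _ _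
        have e1 : Real.exp (-α * ‖x - ν‖ ^ 2) ≤ 1 := by
          apply Real.exp_le_one_iff.2; nlinarith [sq_nonneg ‖x - ν‖]
        nlinarith
      rcases x1.eq_or_lt with y1 | y1
      · right
        have h1 := h.flat (s • x) (by
          rw [mem_closedBall_zero_iff, norm_smul, Real.norm_of_nonneg hs.le]
          exact (hsr x hxG).le) (by rw [inner_smul_right, ← y1, mul_zero])
        have h2 : -(B * s) * ‖x‖ ^ 2 ≤ f x := by
          simp only [hf]
          rw [norm_smul, Real.norm_of_nonneg hs.le] at h1
          refine le_trans (le_of_eq ?_) (mul_le_mul_of_nonneg_left h1 (inv_pos.2 hs).le)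
          field_simp
        refine le_trans ?_ h2
        rw [norm_sub_unit_sq hν, ← y1]
        set t := α * ‖x‖ ^ 2 with ht
        have ht0 : 0 ≤ t := by positivity
        have ht9 : t ≤ 9 * α := by
          have := hG3 x hxG
          have : ‖x‖ ^ 2 ≤ 3 ^ 2 := by gcongr
          rw [ht]; nlinarith
        have e0 : Real.exp (-α * (1 - 2 * 0 + ‖x‖ ^ 2)) = a * Real.exp (-t) := by
          rw [ha, ← Real.exp_add]; congr 1; rw [ht]; ring
        have e1 : Real.exp (-t) ≤ 1 - ‖x‖ ^ 2 * (α / (1 + 9 * α)) := by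
          have e2 : Real.exp (-t) ≤ (1 + t)⁻¹ := by
            rw [Real.exp_neg]
            exact inv_anti₀ (by linarith) (by linarith [Real.add_one_le_exp t])
          have e3 : ‖x‖ ^ 2 * (α / (1 + 9 * α)) = t / (1 + 9 * α) := by rw [ht]; ring
          have e4 : t / (1 + 9 * α) ≤ t / (1 + t) := by gcongr
          have e5 : (1 + t)⁻¹ = 1 - t / (1 + t) := by field_simp; ring
          linarith
        rw [e0]
        have e6 : κ / 2 * (a * Real.exp (-t) - a) ≤
            -(κ / 2 * (a * (α / (1 + 9 * α)))) * ‖x‖ ^ 2 := by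
          have := mul_le_mul_of_nonneg_left e1 (by positivity : 0 ≤ κ / 2 * a)
          linarith
        have := mul_le_mul_of_nonneg_right s6.le (sq_nonneg ‖x‖)
        linarith
      · left
        refine ⟨⟨hsr x hxG, y1⟩, ?_⟩
        filter_upwards [(isOpen_lt continuous_const hic).mem_nhds y1,
          (isOpen_lt continuous_const hnc).mem_nhds y2,
          (isOpen_lt hnc continuous_const).mem_nhds y3] with w w1 w2 w3
        exact ⟨⟨le_of_lt w1, le_of_lt w2⟩, le_of_lt w3⟩

/-- Maximal slopes of two supersolutions with nonnegative sum add up to a nonnegative number. -/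
theorem add_slopes_nonneg {C K₁ K₀ B r : ℝ} {ν : E} {z₁ z₂ : E → ℝ} (hν : ‖ν‖ = 1)
    (hC : 0 ≤ C) (hK₁ : 0 ≤ K₁) (hr : 0 < r)
    (h₁ : HalfBallSuper C K₁ K₀ B r ν z₁) (h₂ : HalfBallSuper C K₁ K₀ B r ν z₂)
    (h : ∀ x ∈ ball (0 : E) r, 0 ≤ ⟪ν, x⟫ → 0 ≤ z₁ x + z₂ x) {m₁ m₂ : ℝ}
    (hm₁ : IsGreatest {m | LowSlope ν z₁ m} m₁) (hm₂ : IsGreatest {m | LowSlope ν z₂ m} m₂) :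
    0 ≤ m₁ + m₂ := by
  by_contra! hcon
  set μ : Measure E := μH[(finrank ℝ E : ℝ)] with hμ
  have : μ.IsAddHaarMeasure := by rw [hμ]; infer_instance
  have hb0 : 0 < μ (ball ν (1 / 8)) := measure_ball_pos _ _ (by norm_num)
  have hbt : μ (ball ν (1 / 8)) ≠ ⊤ := measure_ball_lt_top.ne
  have hω : 0 < μ (ball ν (1 / 8)) / 3 := ENNReal.div_pos hb0.ne' (by simp)
  have hτ : 0 < -(m₁ + m₂) / 3 := by linarith
  have e₁ := (h₁.add_inner hν hK₁ (-m₁)).measure_blowup_le hν hC hK₁ hr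
    (by simpa using isGreatest_lowSlope_add hm₁ (-m₁)) hτ hω
  have e₂ := (h₂.add_inner hν hK₁ (-m₂)).measure_blowup_le hν hC hK₁ hr
    (by simpa using isGreatest_lowSlope_add hm₂ (-m₂)) hτ hω
  obtain ⟨s, s1, s2, s3, s4⟩ := (e₁.and (e₂.and ((eventually_mul_lt 2 hr).and
    self_mem_nhdsWithin))).exists
  have hs : 0 < s := s4
  have hcov : ball ν (1 / 8) ⊆
      {x ∈ ball ν (1 / 8) | -(m₁ + m₂) / 3 < s⁻¹ * (z₁ (s • x) + -m₁ * ⟪ν, s • x⟫)} ∪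
      {x ∈ ball ν (1 / 8) | -(m₁ + m₂) / 3 < s⁻¹ * (z₂ (s • x) + -m₂ * ⟪ν, s • x⟫)} := by
    intro x hx
    by_contra hno
    simp only [mem_union, mem_ofPred_eq, hx, true_and, not_or, not_lt] at hno
    obtain ⟨n1, n2⟩ := hno
    have i1 := inner_pos_of_mem_closedBall hν (ball_subset_closedBall hx)
    rw [mem_ball, dist_eq_norm] at hx
    have hx2 : ‖x‖ < 2 := by have := norm_add_le (x - ν) ν; rw [sub_add_cancel, hν] at this; linarith
    have hz := h (s • x) (by
      rw [mem_ball_zero_iff, norm_smul, Real.norm_of_nonneg hs.le]; nlinarith) (by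
      rw [inner_smul_right]; exact mul_nonneg hs.le (by linarith))
    rw [inner_smul_right] at n1 n2
    rw [inv_mul_le_iff₀ hs] at n1 n2
    have : s * (-(m₁ + m₂) * (⟪ν, x⟫ - 2 / 3)) ≤ 0 := by nlinarith
    have : 0 < s * (-(m₁ + m₂) * (⟪ν, x⟫ - 2 / 3)) :=
      mul_pos hs (mul_pos (by linarith) (by linarith))
    linarith
  have hle : μ (ball ν (1 / 8)) ≤ μ (ball ν (1 / 8)) / 3 + μ (ball ν (1 / 8)) / 3 :=
    (measure_mono hcov).trans ((measure_union_le _ _).trans (add_le_add s1 s2))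
  have hle' := ENNReal.toReal_mono (by finiteness) hle
  rw [ENNReal.toReal_add (by finiteness) (by finiteness), ENNReal.toReal_div] at hle'
  have := ENNReal.toReal_pos hb0.ne' hbt
  norm_num at hle'
  linarith

end BoundaryHarnack

section Transmission

open scoped RealInnerProductSpace

theorem IsClosed.mem_of_forall_exists_norm_sub_le {F : Type*} [SeminormedAddCommGroup F]
    {Z : Set F} (hZ : IsClosed Z) {p : F}
    (h : ∀ δ > 0, ∃ g ∈ Z, ‖g - p‖ ≤ δ) : p ∈ Z := by
  rw [← hZ.closure_eq, Metric.mem_closure_iff]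
  intro ε hε
  obtain ⟨g, hg, hgp⟩ := h (ε / 2) (by positivity)
  exact ⟨g, hg, by rw [dist_comm, dist_eq_norm]; linarith⟩

variable {E : Type*} [NormedAddCommGroup E] [InnerProductSpace ℝ E]

theorem norm_quadratic_gradient_sub_le {ν w : E} (hν : ‖ν‖ = 1) {a b c r : ℝ} (hb : 0 ≤ b)
    (hw : ‖w‖ ≤ r) :
    ‖(a • ν - (2 * b) • w + (2 * c ^ 2 * ⟪ν, w⟫) • ν) - a • ν‖ ≤ 2 * b * r + 2 * c ^ 2 * r := by
  have e : (a • ν - (2 * b) • w + (2 * c ^ 2 * ⟪ν, w⟫) • ν) - a • ν =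
    (2 * c ^ 2 * ⟪ν, w⟫) • ν - (2 * b) • w := by abel
  rw [e]
  refine (norm_sub_le _ _).trans ?_
  rw [norm_smul, norm_smul, hν, Real.norm_eq_abs, Real.norm_eq_abs, abs_mul,
    abs_of_nonneg (by positivity : 0 ≤ 2 * c ^ 2), abs_of_nonneg (by positivity : 0 ≤ 2 * b)]
  have i1 : 2 * c ^ 2 * |⟪ν, w⟫| ≤ 2 * c ^ 2 * r := by
    gcongr; exact (abs_inner_le_norm_of_unit hν w).trans hw
  have i2 : 2 * b * ‖w‖ ≤ 2 * b * r := by gcongr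
  linarith

variable [FiniteDimensional ℝ E]

theorem smul_mem_of_lowSlope_lt {C K₁ K₀ r₀ q m l : ℝ} {ν : E} {z : E → ℝ} {Z : Set E}
    (hν : ‖ν‖ = 1) (hC : 0 ≤ C) (hK₁ : 0 ≤ K₁) (hK₀ : 0 ≤ K₀) (hr₀ : 0 < r₀)
    (hz : ContinuousOn z (closedBall 0 r₀)) (hz0 : z 0 = 0)
    (hm : LowSlope ν z m) (hl : LowSlope (-ν) z l)
    (hjet : PucciJetSuper C K₁ K₀ {x | x ∈ ball 0 r₀ ∧ 0 < ⟪ν, x⟫} z)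
    (hZ : IsClosed Z) (hbelow : JetBelow z {x | x ∈ ball 0 r₀ ∧ ⟪ν, x⟫ ≤ 0} Z)
    (hlq : -l < q) (hqm : q < m) : q • ν ∈ Z := by
  refine hZ.mem_of_forall_exists_norm_sub_le fun δ hδ => ?_
  set A := C + 1 with hA
  have hA0 : 0 < A := by positivity
  set κ := min (min (m - q) (l + q) / A) (δ / (2 + 2 * A)) with hκ
  have hκ0 : 0 < κ := lt_min (div_pos (lt_min (by linarith) (by linarith)) hA0) (by positivity)
  have hκ1 : A * κ ≤ min (m - q) (l + q) := by
    have := min_le_left (min (m - q) (l + q) / A) (δ / (2 + 2 * A))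
    rw [← hκ, le_div_iff₀ hA0] at this; linarith
  have hκ2 : 2 * κ + 2 * (A * κ) ≤ δ := by
    have := min_le_right (min (m - q) (l + q) / A) (δ / (2 + 2 * A))
    rw [← hκ, le_div_iff₀ (by positivity)] at this; linarith
  have hmq := hκ1.trans (min_le_left _ _)
  have hlq' := hκ1.trans (min_le_right _ _)
  set Q := K₁ * (|q| + δ) + K₀ with hQ
  have hQ0 : 0 ≤ Q := by positivity
  obtain ⟨r₁, hr₁, hnear⟩ := Metric.eventually_nhds_iff.1
    ((hm (κ / 2) (by positivity)).and (hl (κ / 2) (by positivity)))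
  obtain ⟨r, hr, hrlt⟩ := exists_between (lt_min (lt_min hr₀ hr₁) (div_pos hκ0
    (by positivity : 0 < Q + 1)))
  have hrr₀ : r < r₀ := hrlt.trans_le ((min_le_left _ _).trans (min_le_left _ _))
  have hrr₁ : r < r₁ := hrlt.trans_le ((min_le_left _ _).trans (min_le_right _ _))
  have hrκ : r * (Q + 1) < κ := by
    have := hrlt.trans_le (min_le_right _ _)
    rwa [lt_div_iff₀ (by positivity)] at this
  set b := κ / r with hb
  have hb0 : 0 < b := by positivity
  have hbr : b * r = κ := by rw [hb]; field_simp
  set c := √(A * b) with hc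
  have hc2 : c ^ 2 = A * b := Real.sq_sqrt (by positivity)
  set φ : E → ℝ := fun x => q * ⟪ν, x⟫ - b * ‖x‖ ^ 2 + c ^ 2 * ⟪ν, x⟫ ^ 2 with hφ
  have hφc : Continuous φ := by fun_prop
  obtain ⟨w, hwG, hw⟩ := (isCompact_closedBall (0 : E) r).exists_isMinOn
    ⟨0, mem_closedBall_self hr.le⟩
    ((hz.mono (closedBall_subset_closedBall hrr₀.le)).sub hφc.continuousOn)
  have hwm : ∀ y ∈ closedBall (0 : E) r, z w - φ w ≤ z y - φ y := fun y hy => hw hy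
  have hw0 : z w - φ w ≤ 0 := by
    have := hwm 0 (mem_closedBall_self hr.le)
    simpa [hφ, hz0] using this
  rw [mem_closedBall_zero_iff] at hwG
  have hwr : ‖w‖ < r := by
    refine lt_of_le_of_ne hwG fun hwe => ?_
    obtain ⟨n1, n2⟩ := hnear (y := w) (by rw [dist_zero_right]; linarith)
    have habs := abs_inner_le_norm_of_unit hν w
    rw [hwe] at n1 n2 habs
    have i1 : b * r ^ 2 = κ * r := by rw [← hbr]; ring
    have hsq : c ^ 2 * ⟪ν, w⟫ ^ 2 ≤ A * κ * |⟪ν, w⟫| := by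
      rw [hc2, ← sq_abs, ← hbr]
      have : A * b * |⟪ν, w⟫| * |⟪ν, w⟫| ≤ A * b * |⟪ν, w⟫| * r := by gcongr
      linarith
    have hκr : 0 < κ * r := by positivity
    simp only [hφ, hwe, i1] at hw0
    rcases le_total 0 ⟪ν, w⟫ with h0 | h0
    · have := n1 h0
      rw [abs_of_nonneg h0] at hsq
      have := mul_le_mul_of_nonneg_right hmq h0
      linarith
    · have h1 := n2 (by rw [inner_neg_left]; linarith)
      rw [inner_neg_left] at h1
      rw [abs_of_nonpos h0] at hsq
      have := mul_le_mul_of_nonneg_right hlq' (neg_nonneg.2 h0)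
      linarith
  have hwn : closedBall (0 : E) r ∈ 𝓝 w :=
    mem_of_superset (isOpen_ball.mem_nhds (mem_ball_zero_iff.2 hwr)) ball_subset_closedBall
  have hgn := norm_quadratic_gradient_sub_le hν (a := q) (c := c) hb0.le hwG
  set g := q • ν - (2 * b) • w + (2 * c ^ 2 * ⟪ν, w⟫) • ν with hg
  have hgδ : ‖g - q • ν‖ ≤ δ := by
    rw [hc2] at hgn
    have : 2 * b * r + 2 * (A * b) * r = 2 * κ + 2 * (A * κ) := by rw [← hbr]; ring
    linarith
  refine ⟨g, ?_, hgδ⟩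
  rcases le_or_gt ⟪ν, w⟫ 0 with h0 | h0
  · refine hbelow.of_isMinOn (φ := φ) (x := w) ⟨mem_ball_zero_iff.2 (hwr.trans hrr₀), h0⟩ hwn
      hwm (g := g) (A := b) (Eventually.of_forall fun y => ?_)
    simp only [hφ]
    rw [quadratic_expand ν w y q b c]
    have : 0 ≤ ⟪c • ν, y - w⟫ ^ 2 := sq_nonneg _
    linarith
  · exfalso
    have := hjet.of_isMinOn (φ := φ) (x := w) ⟨mem_ball_zero_iff.2 (hwr.trans hrr₀), h0⟩ hwn
      hwm (g := g) (e := c • ν) (γ := b) hb0.le (Eventually.of_forall fun y => by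
        simp only [hφ]; exact (quadratic_expand ν w y q b c).ge)
    rw [norm_smul, hν, mul_one, Real.norm_eq_abs, sq_abs, hc2] at this
    have hgq : ‖g‖ ≤ |q| + δ := by
      have h1 := norm_add_le (g - q • ν) (q • ν)
      rw [sub_add_cancel, norm_smul, hν, mul_one, Real.norm_eq_abs] at h1
      linarith
    have h2 := mul_le_mul_of_nonneg_left hgq hK₁
    have h3 : b ≤ Q := by rw [hQ]; rw [hA] at this; linarith
    have h4 := mul_le_mul_of_nonneg_right h3 hr.le
    linarith

theorem smul_mem_of_lowSlope {C K₁ K₀ r₀ q m l : ℝ} {ν : E} {z : E → ℝ} {Z : Set E}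
    (hν : ‖ν‖ = 1) (hC : 0 ≤ C) (hK₁ : 0 ≤ K₁) (hK₀ : 0 ≤ K₀) (hr₀ : 0 < r₀)
    (hz : ContinuousOn z (closedBall 0 r₀)) (hz0 : z 0 = 0)
    (hm : LowSlope ν z m) (hl : LowSlope (-ν) z l)
    (hjet : PucciJetSuper C K₁ K₀ {x | x ∈ ball 0 r₀ ∧ 0 < ⟪ν, x⟫} z)
    (hZ : IsClosed Z) (hbelow : JetBelow z {x | x ∈ ball 0 r₀ ∧ ⟪ν, x⟫ ≤ 0} Z)
    (hlm : -l < m) (hq : q ∈ Icc (-l) m) : q • ν ∈ Z := by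
  have hcl : IsClosed {q : ℝ | q • ν ∈ Z} := hZ.preimage (by fun_prop)
  rw [← closure_Ioo hlm.ne] at hq
  exact hcl.closure_subset_iff.2 (fun q hq => smul_mem_of_lowSlope_lt hν hC hK₁ hK₀ hr₀ hz hz0
    hm hl hjet hZ hbelow hq.1 hq.2) hq

/-- The critical slope is attained as a limit of gradients of touching paraboloids. -/
theorem smul_mem_of_isGreatest_lowSlope {B r₀ l : ℝ} {ν : E} {z : E → ℝ} {Z : Set E}
    (hν : ‖ν‖ = 1) (hr₀ : 0 < r₀)
    (hz : ContinuousOn z {x | x ∈ closedBall 0 r₀ ∧ 0 ≤ ⟪ν, x⟫})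
    (hflat : ∀ x ∈ closedBall (0 : E) r₀, ⟪ν, x⟫ = 0 → -B * ‖x‖ ^ 2 ≤ z x)
    (hl : IsGreatest {m | LowSlope ν z m} l)
    (hZ : IsClosed Z) (hbelow : JetBelow z {x | x ∈ ball 0 r₀ ∧ 0 < ⟪ν, x⟫} Z) : l • ν ∈ Z := by
  refine hZ.mem_of_forall_exists_norm_sub_le fun δ hδ => ?_
  set κ := δ / 4 with hκ
  have hκ0 : 0 < κ := by positivity
  obtain ⟨r₁, hr₁, hnear⟩ := Metric.eventually_nhds_iff.1 (hl.1 (κ / 4) (by positivity))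
  obtain ⟨r, hr, hrlt⟩ := exists_between (lt_min (lt_min hr₀ hr₁) (div_pos hκ0
    (by positivity : 0 < |B| + 1)))
  have hrr₀ : r < r₀ := hrlt.trans_le ((min_le_left _ _).trans (min_le_left _ _))
  have hrr₁ : r < r₁ := hrlt.trans_le ((min_le_left _ _).trans (min_le_right _ _))
  have hrκ : r * (|B| + 1) < κ := by
    have := hrlt.trans_le (min_le_right _ _)
    rwa [lt_div_iff₀ (by positivity)] at this
  set b := κ / r with hb
  have hb0 : 0 < b := by positivity
  have hbr : b * r = κ := by rw [hb]; field_simp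
  have hBb : B ≤ b := by
    rw [hb, le_div_iff₀ hr]
    have := mul_le_mul_of_nonneg_right (le_abs_self B) hr.le
    linarith
  set l' := l + κ / 2 with hl'
  set φ : E → ℝ := fun x => l' * ⟪ν, x⟫ - b * ‖x‖ ^ 2 with hφ
  have hφc : Continuous φ := by fun_prop
  have hsub : {x : E | x ∈ closedBall 0 r ∧ 0 ≤ ⟪ν, x⟫} ⊆ {x | x ∈ closedBall 0 r₀ ∧ 0 ≤ ⟪ν, x⟫} :=
    fun x hx => ⟨closedBall_subset_closedBall hrr₀.le hx.1, hx.2⟩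
  obtain ⟨w, hwG, hw⟩ := (isCompact_halfBall ν r).exists_isMinOn
    ⟨0, mem_closedBall_self hr.le, by simp⟩ ((hz.mono hsub).sub hφc.continuousOn)
  have hwm : ∀ y ∈ {x : E | x ∈ closedBall 0 r ∧ 0 ≤ ⟪ν, x⟫}, z w - φ w ≤ z y - φ y :=
    fun y hy => hw hy
  have hw0 : z w - φ w < 0 := by
    have hnot : ¬ LowSlope ν z l' := fun h => by
      have : l' ≤ l := hl.2 h
      linarith
    rw [LowSlope] at hnot
    push Not at hnot
    obtain ⟨ε, hε, hfreq⟩ := hnot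
    have c1 : ∀ᶠ x : E in 𝓝 0, ‖x‖ < r :=
      continuous_norm.continuousAt.eventually_lt_const (by simpa using hr)
    have c2 : ∀ᶠ x : E in 𝓝 0, b * ‖x‖ < ε := by
      have : Continuous fun x : E => b * ‖x‖ := by fun_prop
      exact this.continuousAt.eventually_lt_const (by simpa using hε)
    obtain ⟨x, ⟨x1, x2⟩, x3, x4⟩ := (hfreq.and_eventually (c1.and c2)).exists
    refine (hwm x ⟨mem_closedBall_zero_iff.2 x3.le, x1⟩).trans_lt ?_
    simp only [hφ]
    have := mul_le_mul_of_nonneg_right x4.le (norm_nonneg x)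
    linarith
  have hwle := hwG.1
  rw [mem_closedBall_zero_iff] at hwle
  have hwpos : 0 < ⟪ν, w⟫ := by
    refine lt_of_le_of_ne hwG.2 fun he => ?_
    have h1 := hflat w (hsub hwG).1 he.symm
    simp only [hφ, ← he] at hw0
    have := mul_le_mul_of_nonneg_right hBb (sq_nonneg ‖w‖)
    linarith
  have hwr : ‖w‖ < r := by
    refine lt_of_le_of_ne hwle fun hwe => ?_
    have n1 := hnear (y := w) (by rw [dist_zero_right]; linarith) hwpos.le
    have i1 : b * r ^ 2 = κ * r := by rw [← hbr]; ring
    simp only [hφ, hwe, i1] at hw0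
    rw [hwe] at n1
    have habs := inner_le_norm_of_unit hν w
    rw [hwe] at habs
    have := mul_le_mul_of_nonneg_left habs hκ0.le
    have : 0 < κ * r := by positivity
    rw [hl'] at hw0
    linarith
  have hgn := norm_quadratic_gradient_sub_le hν (a := l') (c := 0) hb0.le hwle
  set g := l' • ν - (2 * b) • w + (2 * (0 : ℝ) ^ 2 * ⟪ν, w⟫) • ν with hg
  refine ⟨g, ?_, ?_⟩
  · refine hbelow.of_isMinOn (φ := φ) (x := w) ⟨mem_ball_zero_iff.2 (hwr.trans hrr₀), hwpos⟩
      (halfBall_mem_nhds hwr hwpos) hwm (g := g) (A := b) (Eventually.of_forall fun y => ?_)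
    have := quadratic_expand ν w y l' b 0
    simp only [zero_smul, inner_zero_left] at this
    simp only [hφ]
    simp only [hg]
    linarith
  · have h1 : ‖l' • ν - l • ν‖ = κ / 2 := by
      rw [← sub_smul, norm_smul, hν, mul_one, hl', add_sub_cancel_left,
        Real.norm_of_nonneg (by positivity)]
    have h2 := norm_sub_le_norm_sub_add_norm_sub g (l' • ν) (l • ν)
    have h3 : 2 * b * r = 2 * κ := by rw [← hbr]; ring
    rw [h3] at hgn
    linarith

end Transmission

section Directional

open scoped RealInnerProductSpace

theorem sq_max_zero_le (s t : ℝ) :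
    max t 0 ^ 2 ≤ max s 0 ^ 2 + 2 * max s 0 * (t - s) + (t - s) ^ 2 := by
  rcases le_total s 0 with hs | hs <;> rcases le_total t 0 with ht | ht <;>
    simp only [max_eq_left, max_eq_right, hs, ht] <;> nlinarith

variable {E : Type*} [NormedAddCommGroup E] [InnerProductSpace ℝ E]

theorem tube_expand (ν ξ w D : E) (h t c N M : ℝ) (hN : 0 ≤ N) (hM : 0 ≤ M) (hν : ‖ν‖ = 1) :
    c * h - N * ‖w‖ ^ 2 - M * max (h - t) 0 ^ 2 +
      ⟪c • ν - (2 * N) • (w - ⟪ξ, w⟫ • ν) - (2 * M * max (h - t) 0) • ν, D⟫ -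
      (N * (1 + ‖ξ‖) ^ 2 + M) * ‖D‖ ^ 2 ≤
    c * (h + ⟪ν, D⟫) - N * ‖w + (D - ⟪ν, D⟫ • ξ)‖ ^ 2 - M * max (h + ⟪ν, D⟫ - t) 0 ^ 2 := by
  have h1 := mul_le_mul_of_nonneg_left (sq_max_zero_le (h - t) (h + ⟪ν, D⟫ - t)) hM
  have h2 : ‖D - ⟪ν, D⟫ • ξ‖ ^ 2 ≤ (1 + ‖ξ‖) ^ 2 * ‖D‖ ^ 2 := by
    rw [← mul_pow]
    gcongr
    refine (norm_sub_le _ _).trans ?_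
    rw [norm_smul, Real.norm_eq_abs]
    have := mul_le_mul_of_nonneg_right (abs_inner_le_norm_of_unit hν D) (norm_nonneg ξ)
    linarith
  have h2' := mul_le_mul_of_nonneg_left h2 hN
  have h3 : ⟪ν, D⟫ ^ 2 ≤ ‖D‖ ^ 2 := by
    rw [← sq_abs ⟪ν, D⟫]
    gcongr
    exact abs_inner_le_norm_of_unit hν D
  have h3' := mul_le_mul_of_nonneg_left h3 hM
  have e : h + ⟪ν, D⟫ - t - (h - t) = ⟪ν, D⟫ := by ring
  rw [e] at h1
  rw [norm_add_sq_real]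
  simp only [inner_sub_left, inner_sub_right, inner_smul_left, inner_smul_right,
    RCLike.conj_to_real]
  rw [real_inner_comm w ξ]
  linarith

variable [FiniteDimensional ℝ E]

/-- A lower bound on the `ξ`-component of all touching gradients gives growth along `ξ`. -/
theorem JetBelow.add_mul_le {S Z : Set E} {z : E → ℝ} {ν ξ : E} {c₁ : ℝ} (hν : ‖ν‖ = 1)
    (hξ : ⟪ν, ξ⟫ = 1) (hS : IsOpen S) (hz : ContinuousOn z S) (h : JetBelow z S Z)
    (hZ : ∀ g ∈ Z, c₁ ≤ ⟪ξ, g⟫) {x : E} {T : ℝ} (hT : 0 ≤ T)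
    (hseg : ∀ t ∈ Icc 0 T, x + t • ξ ∈ S) : z x + c₁ * T ≤ z (x + T • ξ) := by
  rcases hT.eq_or_lt with rfl | hT
  · simp
  by_contra! hcon
  obtain ⟨c, hc1, hc2⟩ : ∃ c, z (x + T • ξ) < z x + c * T ∧ c < c₁ := by
    refine ⟨((z (x + T • ξ) - z x) / T + c₁) / 2, ?_, ?_⟩
    · have : (z (x + T • ξ) - z x) / T < c₁ := by rw [div_lt_iff₀ hT]; linarith
      have h2 : (z (x + T • ξ) - z x) / T < ((z (x + T • ξ) - z x) / T + c₁) / 2 := by linarith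
      rw [div_lt_iff₀ hT] at h2
      linarith
    · have : (z (x + T • ξ) - z x) / T < c₁ := by rw [div_lt_iff₀ hT]; linarith
      linarith
  have hK : IsCompact ((fun t : ℝ => x + t • ξ) '' Icc 0 T) :=
    isCompact_Icc.image (by fun_prop)
  obtain ⟨δ, hδ, hδS⟩ := hK.exists_cthickening_subset_open hS (by rintro _ ⟨t, ht, rfl⟩; exact hseg t ht)
  have hx : x ∈ S := by simpa using hseg 0 ⟨le_rfl, hT.le⟩
  obtain ⟨ρ₁, hρ₁, hnear⟩ := Metric.eventually_nhds_iff.1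
    ((hz.continuousAt (hS.mem_nhds hx)).eventually_const_lt
      (by linarith : z (x + T • ξ) - c * T < z x))
  set ρ := min (ρ₁ / 2) (δ / (1 + ‖ξ‖)) with hρ
  have hρ0 : 0 < ρ := lt_min (by positivity) (by positivity)
  have hρδ : ρ * (1 + ‖ξ‖) ≤ δ := by
    have := min_le_right (ρ₁ / 2) (δ / (1 + ‖ξ‖))
    rwa [← hρ, le_div_iff₀ (by positivity)] at this
  set hh : E → ℝ := fun y => ⟪ν, y - x⟫ with hhh
  set ww : E → E := fun y => y - x - hh y • ξ with hww
  have hhc : Continuous hh := by fun_prop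
  have hwc : Continuous ww := by fun_prop
  set G : Set E := {y | ‖ww y‖ ≤ ρ} ∩ {y | 0 ≤ hh y} ∩ {y | hh y ≤ T + ρ} with hG
  have hyw : ∀ y, y = x + hh y • ξ + ww y := fun y => by simp only [hww]; abel
  have hGS : G ⊆ S := by
    rintro y ⟨⟨y1, y2⟩, y3⟩
    rw [mem_ofPred_eq] at y1 y2 y3
    apply hδS
    have hmin : x + min (hh y) T • ξ ∈ (fun t : ℝ => x + t • ξ) '' Icc 0 T :=
      ⟨min (hh y) T, ⟨le_min y2 hT.le, min_le_right _ _⟩, rfl⟩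
    refine mem_cthickening_of_dist_le y _ δ _ hmin ?_
    rw [dist_eq_norm]
    have e : y - (x + min (hh y) T • ξ) = ww y + (hh y - min (hh y) T) • ξ := by
      simp only [hww, sub_smul]; abel
    rw [e]
    refine (norm_add_le _ _).trans ?_
    have h0 : 0 ≤ hh y - min (hh y) T := sub_nonneg.2 (min_le_left _ _)
    rw [norm_smul, Real.norm_of_nonneg h0]
    have h1 : hh y - min (hh y) T ≤ ρ := by
      rcases min_cases (hh y) T with ⟨e, _⟩ | ⟨e, _⟩ <;> rw [e] <;> linarith
    have := mul_le_mul_of_nonneg_right h1 (norm_nonneg ξ)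
    linarith
  have hGc : IsCompact G := by
    refine (isCompact_closedBall x ((T + ρ) * ‖ξ‖ + ρ)).of_isClosed_subset
      (((isClosed_le hwc.norm continuous_const).inter (isClosed_le continuous_const hhc)).inter
        (isClosed_le hhc continuous_const)) ?_
    rintro y ⟨⟨y1, y2⟩, y3⟩
    rw [mem_ofPred_eq] at y1 y2 y3
    rw [mem_closedBall, dist_eq_norm]
    have e : y - x = hh y • ξ + ww y := by simp only [hww]; abel
    rw [e]
    refine (norm_add_le _ _).trans ?_
    rw [norm_smul, Real.norm_of_nonneg y2]
    have := mul_le_mul_of_nonneg_right y3 (norm_nonneg ξ)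
    linarith
  obtain ⟨b, hb⟩ := hGc.exists_bound_of_continuousOn (hz.mono hGS)
  have hhT : hh (x + T • ξ) = T := by simp [hhh, inner_smul_right, hξ]
  have hwT : ww (x + T • ξ) = 0 := by simp [hww, hhT]
  have hTG : x + T • ξ ∈ G := by
    refine ⟨⟨?_, ?_⟩, ?_⟩ <;> rw [mem_ofPred_eq]
    · rw [hwT, norm_zero]; exact hρ0.le
    · rw [hhT]; exact hT.le
    · rw [hhT]; linarith
  have hb0 : 0 ≤ b := (norm_nonneg _).trans (hb _ hTG)
  set N := (2 * b + 2 * |c| * (T + ρ) + 1) / ρ ^ 2 with hN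
  have hN0 : 0 ≤ N := by positivity
  have hNρ : N * ρ ^ 2 = 2 * b + 2 * |c| * (T + ρ) + 1 := by rw [hN]; field_simp
  set φ : E → ℝ := fun y => c * hh y - N * ‖ww y‖ ^ 2 - N * max (hh y - T) 0 ^ 2 with hφ
  have hφc : Continuous φ := by fun_prop
  obtain ⟨y, hyG, hy⟩ := hGc.exists_isMinOn ⟨_, hTG⟩ ((hz.mono hGS).sub hφc.continuousOn)
  have hym : ∀ y' ∈ G, z y - φ y ≤ z y' - φ y' := fun y' hy' => hy hy'
  have hyT : z y - φ y ≤ z (x + T • ξ) - c * T := by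
    have := hym _ hTG
    simpa [hφ, hhT, hwT] using this
  have hbound : ∀ y' ∈ G, |z y'| ≤ b := fun y' hy' => hb y' hy'
  have hpen : N * ‖ww y‖ ^ 2 + N * max (hh y - T) 0 ^ 2 < N * ρ ^ 2 := by
    have h1 := (abs_le.1 (hbound y hyG)).1
    have h2 := (abs_le.1 (hbound _ hTG)).2
    have h3 : c * hh y - c * T ≤ 2 * |c| * (T + ρ) := by
      have h4 : |hh y - T| ≤ T + ρ := by
        have := hyG.1.2; have := hyG.2; rw [mem_ofPred_eq] at *
        rw [abs_le]; constructor <;> linarith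
      have h5 := le_abs_self (c * (hh y - T))
      rw [abs_mul] at h5
      have h6 := mul_le_mul_of_nonneg_left h4 (abs_nonneg c)
      have : 0 ≤ |c| * (T + ρ) := by positivity
      linarith
    simp only [hφ] at hyT
    rw [hNρ]
    linarith
  have hNpos : 0 < N := by positivity
  have hw1 : ‖ww y‖ < ρ := by
    have : N * ‖ww y‖ ^ 2 < N * ρ ^ 2 := by
      have : 0 ≤ N * max (hh y - T) 0 ^ 2 := by positivity
      linarith
    exact lt_of_pow_lt_pow_left₀ 2 hρ0.le (lt_of_mul_lt_mul_left this hNpos.le)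
  have hw2 : hh y < T + ρ := by
    have : N * max (hh y - T) 0 ^ 2 < N * ρ ^ 2 := by
      have : 0 ≤ N * ‖ww y‖ ^ 2 := by positivity
      linarith
    have := lt_of_pow_lt_pow_left₀ 2 hρ0.le (lt_of_mul_lt_mul_left this hNpos.le)
    have := le_max_left (hh y - T) 0
    linarith
  have hw3 : 0 < hh y := by
    refine lt_of_le_of_ne hyG.1.2 fun he => ?_
    have e : y = x + ww y := by simp only [hww, ← he]; simp
    have := hnear (y := y) (by
      rw [dist_eq_norm, e, add_sub_cancel_left]
      have := min_le_left (ρ₁ / 2) (δ / (1 + ‖ξ‖))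
      linarith)
    simp only [hφ, ← he] at hyT
    have : 0 ≤ N * ‖ww y‖ ^ 2 := by positivity
    have : 0 ≤ N * max (0 - T) 0 ^ 2 := by positivity
    linarith
  have hGn : G ∈ 𝓝 y := by
    filter_upwards [(isOpen_lt hwc.norm continuous_const).mem_nhds hw1,
      (isOpen_lt continuous_const hhc).mem_nhds hw3,
      (isOpen_lt hhc continuous_const).mem_nhds hw2] with y' h1 h2 h3
    exact ⟨⟨le_of_lt h1, le_of_lt h2⟩, le_of_lt h3⟩
  have hg := hZ _ (h.of_isMinOn (hGS hyG) hGn hym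
    (g := c • ν - (2 * N) • (ww y - ⟪ξ, ww y⟫ • ν) - (2 * N * max (hh y - T) 0) • ν)
    (A := N * (1 + ‖ξ‖) ^ 2 + N) (Eventually.of_forall fun y' => by
      have e1 : hh y' = hh y + ⟪ν, y' - y⟫ := by
        simp only [hhh, ← inner_add_right]; congr 1; abel
      have e2 : ww y' = ww y + ((y' - y) - ⟪ν, y' - y⟫ • ξ) := by
        simp only [hww, e1, add_smul]; abel
      have := tube_expand ν ξ (ww y) (y' - y) (hh y) T c N N hN0 hN0 hν
      simp only [hφ]
      rw [e2, e1]
      exact this))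
  have hξ' : ⟪ξ, ν⟫ = 1 := by rw [real_inner_comm]; exact hξ
  simp only [inner_sub_right, inner_smul_right, hξ'] at hg
  have : 0 ≤ 2 * N * max (hh y - T) 0 := by positivity
  linarith

/-- Boundary version of the growth estimate in the half-ball `⟪ν, x⟫ < 0`. -/
theorem JetBelow.lowSlope_neg {Z : Set E} {z : E → ℝ} {ν ξ : E} {c₁ r B : ℝ} (hν : ‖ν‖ = 1)
    (hr : 0 < r) (hξ : ⟪ν, ξ⟫ = 1) (hz : ContinuousOn z {x | x ∈ closedBall 0 r ∧ 0 ≤ ⟪-ν, x⟫})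
    (h : JetBelow z {x | x ∈ ball 0 r ∧ 0 < ⟪-ν, x⟫} Z)
    (hflat : ∀ x ∈ closedBall (0 : E) r, ⟪ν, x⟫ = 0 → z x ≤ B * ‖x‖ ^ 2)
    (hZ : ∀ g ∈ Z, c₁ ≤ ⟪ξ, g⟫) : LowSlope (-ν) (fun x => -z x) c₁ := by
  intro ε hε
  have c1 : ∀ᶠ x : E in 𝓝 0, ‖x‖ * (1 + ‖ξ‖) < r := by
    have : Continuous fun x : E => ‖x‖ * (1 + ‖ξ‖) := by fun_prop
    exact this.continuousAt.eventually_lt_const (by simpa using hr)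
  have c2 : ∀ᶠ x : E in 𝓝 0, |B| * (1 + ‖ξ‖) ^ 2 * ‖x‖ < ε := by
    have : Continuous fun x : E => |B| * (1 + ‖ξ‖) ^ 2 * ‖x‖ := by fun_prop
    exact this.continuousAt.eventually_lt_const (by simpa using hε)
  filter_upwards [c1, c2] with x h1 h2 h3
  set T := ⟪-ν, x⟫ with hT
  have hTx : T ≤ ‖x‖ := inner_le_norm_of_unit (by rwa [norm_neg]) x
  have hn : ∀ t ∈ Icc 0 T, ‖x + t • ξ‖ ≤ ‖x‖ * (1 + ‖ξ‖) := fun t ht => by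
    refine (norm_add_le _ _).trans ?_
    rw [norm_smul, Real.norm_of_nonneg ht.1]
    have := mul_le_mul_of_nonneg_right (ht.2.trans hTx) (norm_nonneg ξ)
    linarith
  have hi : ∀ t : ℝ, ⟪-ν, x + t • ξ⟫ = T - t := fun t => by
    rw [inner_add_right, inner_smul_right, inner_neg_left ν ξ, hξ, ← hT]; ring
  have hlast : z x + c₁ * T ≤ z (x + T • ξ) := by
    rcases h3.eq_or_lt with h0 | h0
    · rw [← h0]; simp
    have hopen : IsOpen {x : E | x ∈ ball 0 r ∧ 0 < ⟪-ν, x⟫} :=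
      (isOpen_ball (x := (0 : E)) (ε := r)).inter
        (isOpen_lt continuous_const (by fun_prop : Continuous fun x : E => ⟪-ν, x⟫))
    have hcl : ContinuousOn (fun t : ℝ => z (x + t • ξ) - (z x + c₁ * t)) (Icc 0 T) := by
      refine ContinuousOn.sub ?_ (by fun_prop)
      refine hz.comp (by fun_prop) fun t ht => ⟨?_, ?_⟩
      · rw [mem_closedBall_zero_iff]; linarith [hn t ht]
      · rw [hi]; linarith [ht.2]
    have hIco : ∀ t ∈ Ico 0 T, 0 ≤ z (x + t • ξ) - (z x + c₁ * t) := fun t ht => by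
      have := h.add_mul_le hν hξ hopen (hz.mono fun y hy => ⟨ball_subset_closedBall hy.1, hy.2.le⟩)
        hZ ht.1 (x := x) fun t' ht' => ⟨by
          rw [mem_ball_zero_iff]; linarith [hn t' ⟨ht'.1, ht'.2.trans ht.2.le⟩], by
          rw [hi]; linarith [ht'.2, ht.2]⟩
      linarith
    have hTc : T ∈ closure (Ico 0 T) := by
      rw [closure_Ico h0.ne]; exact ⟨h0.le, le_rfl⟩
    have := ContinuousWithinAt.closure_le (f := fun _ => (0 : ℝ)) hTc continuousWithinAt_const
      ((hcl T ⟨h0.le, le_rfl⟩).mono Ico_subset_Icc_self) hIco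
    linarith
  have hTT : T ∈ Icc 0 T := ⟨h3, le_rfl⟩
  have h5 := hflat (x + T • ξ) (by rw [mem_closedBall_zero_iff]; linarith [hn T hTT]) (by
    have := hi T; rw [inner_neg_left] at this; linarith)
  have h6 : B * ‖x + T • ξ‖ ^ 2 ≤ |B| * (‖x‖ * (1 + ‖ξ‖)) ^ 2 := by
    have := hn T hTT
    have := le_abs_self B
    gcongr
  have h7 := mul_le_mul_of_nonneg_right h2.le (norm_nonneg x)
  have h8 : |B| * (‖x‖ * (1 + ‖ξ‖)) ^ 2 = |B| * (1 + ‖ξ‖) ^ 2 * ‖x‖ * ‖x‖ := by ring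
  linarith

end Directional

section Comparison

open scoped RealInnerProductSpace

variable {E : Type*} [NormedAddCommGroup E] [InnerProductSpace ℝ E]

theorem LowSlope.mono {ν : E} {z z' : E → ℝ} {m r : ℝ} (h : LowSlope ν z m) (hr : 0 < r)
    (hz : ∀ x ∈ closedBall (0 : E) r, z x ≤ z' x) : LowSlope ν z' m := by
  intro ε hε
  filter_upwards [h ε hε, closedBall_mem_nhds (0 : E) hr] with x h1 h2 h3
  exact (h1 h3).trans (hz x h2)

theorem lowSlope_of_lipschitz {ν : E} (hν : ‖ν‖ = 1) {z : E → ℝ} {L B r : ℝ} (hr : 0 < r)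
    (hL : ∀ x ∈ closedBall (0 : E) r, ∀ y ∈ closedBall (0 : E) r, 0 ≤ ⟪ν, x⟫ → 0 ≤ ⟪ν, y⟫ →
      z x - z y ≤ L * ‖x - y‖)
    (hflat : ∀ x ∈ closedBall (0 : E) r, ⟪ν, x⟫ = 0 → -B * ‖x‖ ^ 2 ≤ z x) :
    LowSlope ν z (-L) := by
  intro ε hε
  have c2 : ∀ᶠ x : E in 𝓝 0, |B| * ‖x‖ < ε := by
    have : Continuous fun x : E => |B| * ‖x‖ := by fun_prop
    exact this.continuousAt.eventually_lt_const (by simpa using hε)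
  filter_upwards [closedBall_mem_nhds (0 : E) hr, c2] with x h1 h2 h3
  have hi : ⟪ν, x - ⟪ν, x⟫ • ν⟫ = 0 := by
    rw [inner_sub_right, inner_smul_right, real_inner_self_eq_norm_sq, hν]; ring
  have hn : ‖x - ⟪ν, x⟫ • ν‖ ^ 2 ≤ ‖x‖ ^ 2 := by
    rw [norm_sub_sq_real, norm_smul, inner_smul_right, hν, Real.norm_eq_abs, real_inner_comm,
      mul_one, sq_abs]
    nlinarith [sq_nonneg ⟪ν, x⟫]
  have hn' : ‖x - ⟪ν, x⟫ • ν‖ ≤ ‖x‖ := le_of_sq_le_sq hn (norm_nonneg _)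
  rw [mem_closedBall_zero_iff] at h1
  have hm : x - ⟪ν, x⟫ • ν ∈ closedBall (0 : E) r := by rw [mem_closedBall_zero_iff]; linarith
  have h4 := hL _ hm x (mem_closedBall_zero_iff.2 h1) hi.ge h3
  rw [sub_sub_cancel_left, norm_neg, norm_smul, hν, Real.norm_of_nonneg h3] at h4
  have h5 := hflat _ hm hi
  have h6 : B * ‖x - ⟪ν, x⟫ • ν‖ ^ 2 ≤ |B| * ‖x‖ ^ 2 := by
    have := le_abs_self B
    gcongr
  have h7 := mul_le_mul_of_nonneg_right h2.le (norm_nonneg x)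
  linarith

variable [FiniteDimensional ℝ E] [MeasurableSpace E] [BorelSpace E]

theorem false_of_touching {C K₁ K₀ B L r η : ℝ} {ν P : E} {H z₁ z₂ : E → ℝ} (hν : ‖ν‖ = 1)
    (hC : 0 ≤ C) (hK₁ : 0 ≤ K₁) (hK₀ : 0 ≤ K₀) (hB : 0 ≤ B) (hr : 0 < r) (hη : 0 < η)
    (hH : Continuous H) (hconv : Convex ℝ {p | H p ≤ -η})
    (hz₁ : ContinuousOn z₁ (closedBall 0 r)) (hz₂ : ContinuousOn z₂ (closedBall 0 r))
    (h0₁ : z₁ 0 = 0) (h0₂ : z₂ 0 = 0) (hsum : ∀ x ∈ closedBall (0 : E) r, -z₁ x ≤ z₂ x)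
    (hflat₁ : ∀ x ∈ closedBall (0 : E) r, ⟪ν, x⟫ = 0 → |z₁ x| ≤ B * ‖x‖ ^ 2)
    (hflat₂ : ∀ x ∈ closedBall (0 : E) r, ⟪ν, x⟫ = 0 → |z₂ x| ≤ B * ‖x‖ ^ 2)
    (hL₁ : ∀ x ∈ closedBall (0 : E) r, ∀ y ∈ closedBall (0 : E) r, ⟪ν, x⟫ ≤ 0 → ⟪ν, y⟫ ≤ 0 →
      z₁ x - z₁ y ≤ L * ‖x - y‖)
    (hL₂ : ∀ x ∈ closedBall (0 : E) r, ∀ y ∈ closedBall (0 : E) r, ⟪ν, x⟫ ≤ 0 → ⟪ν, y⟫ ≤ 0 →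
      z₂ x - z₂ y ≤ L * ‖x - y‖)
    (hJ₁ : PucciJetSuper C K₁ K₀ {x | x ∈ ball 0 r ∧ 0 < ⟪ν, x⟫} z₁)
    (hJ₁' : PucciJetSuper C K₁ K₀ {x | x ∈ ball 0 r ∧ 0 < ⟪ν, x⟫} (fun x => -z₁ x))
    (hJ₂ : PucciJetSuper C K₁ K₀ {x | x ∈ ball 0 r ∧ 0 < ⟪ν, x⟫} z₂)
    (hJ₂' : PucciJetSuper C K₁ K₀ {x | x ∈ ball 0 r ∧ 0 < ⟪ν, x⟫} (fun x => -z₂ x))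
    (hb₁ : JetBelow z₁ {x | x ∈ ball 0 r ∧ ⟪ν, x⟫ ≤ 0} {g | H (P - g) ≤ -η})
    (hb₂ : JetBelow z₂ {x | x ∈ ball 0 r ∧ ⟪ν, x⟫ ≤ 0} {g | 0 ≤ H (P + g)}) : False := by
  have hν' : ‖-ν‖ = 1 := by rwa [norm_neg]
  have hν1 : ⟪ν, ν⟫ = 1 := by rw [real_inner_self_eq_norm_sq, hν]; norm_num
  have hZ₁ : IsClosed {g | H (P - g) ≤ -η} := isClosed_le (by fun_prop) continuous_const
  have hZ₂ : IsClosed {g | 0 ≤ H (P + g)} := isClosed_le continuous_const (by fun_prop)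
  have hsuper : ∀ {z : E → ℝ}, ContinuousOn z (closedBall 0 r) →
      PucciJetSuper C K₁ K₀ {x | x ∈ ball 0 r ∧ 0 < ⟪ν, x⟫} z →
      (∀ x ∈ closedBall (0 : E) r, ⟪ν, x⟫ = 0 → |z x| ≤ B * ‖x‖ ^ 2) →
      HalfBallSuper C K₁ K₀ B r ν z := fun h1 h2 h3 =>
    ⟨h1.mono fun x hx => hx.1, h2, fun x hx h0 => by
      have := (abs_le.1 (h3 x hx h0)).1; linarith⟩
  have hs₁ := hsuper hz₁ hJ₁ hflat₁
  have hs₂ := hsuper hz₂ hJ₂ hflat₂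
  have hs₁' := hsuper hz₁.neg hJ₁' fun x hx h0 => by simpa using hflat₁ x hx h0
  have hs₂' := hsuper hz₂.neg hJ₂' fun x hx h0 => by simpa using hflat₂ x hx h0
  have hbot : ∀ {z : E → ℝ}, (∀ x ∈ closedBall (0 : E) r, ∀ y ∈ closedBall (0 : E) r,
      ⟪ν, x⟫ ≤ 0 → ⟪ν, y⟫ ≤ 0 → z x - z y ≤ L * ‖x - y‖) →
      (∀ x ∈ closedBall (0 : E) r, ⟪ν, x⟫ = 0 → |z x| ≤ B * ‖x‖ ^ 2) →
      ∃ l, IsGreatest {m | LowSlope (-ν) z m} l := by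
    intro z h1 h2
    refine exists_isGreatest_lowSlope hν' (m := -L) (m' := -L)
      (lowSlope_of_lipschitz (B := B) hν' hr (fun x hx y hy hx0 hy0 => ?_) fun x hx h0 => ?_)
      (lowSlope_of_lipschitz (B := B) hν' hr (fun x hx y hy hx0 hy0 => ?_) fun x hx h0 => ?_)
    · rw [inner_neg_left] at hx0 hy0
      exact h1 x hx y hy (by linarith) (by linarith)
    · rw [inner_neg_left, neg_eq_zero] at h0
      have := (abs_le.1 (h2 x hx h0)).1; linarith
    · rw [inner_neg_left] at hx0 hy0
      have := h1 y hy x hx (by linarith) (by linarith)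
      rw [norm_sub_rev] at this; linarith
    · rw [inner_neg_left, neg_eq_zero] at h0
      have := (abs_le.1 (h2 x hx h0)).2; linarith
  obtain ⟨l₁, hl₁⟩ := hbot hL₁ hflat₁
  obtain ⟨l₂, hl₂⟩ := hbot hL₂ hflat₂
  obtain ⟨_, ha₁⟩ := hs₁.exists_lowSlope hν hC hK₁ hK₀ hB hr
  obtain ⟨_, ha₁'⟩ := hs₁'.exists_lowSlope hν hC hK₁ hK₀ hB hr
  obtain ⟨_, ha₂⟩ := hs₂.exists_lowSlope hν hC hK₁ hK₀ hB hr
  obtain ⟨_, ha₂'⟩ := hs₂'.exists_lowSlope hν hC hK₁ hK₀ hB hr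
  obtain ⟨m₁, hm₁⟩ := exists_isGreatest_lowSlope hν ha₁ ha₁'
  obtain ⟨m₂, hm₂⟩ := exists_isGreatest_lowSlope hν ha₂ ha₂'
  have hmm := add_slopes_nonneg hν hC hK₁ hr hs₁ hs₂
    (fun x hx _ => by linarith [hsum x (ball_subset_closedBall hx)]) hm₁ hm₂
  have hsubset : {x : E | x ∈ ball 0 r ∧ 0 < ⟪-ν, x⟫} ⊆ {x | x ∈ ball 0 r ∧ ⟪ν, x⟫ ≤ 0} :=
    fun x hx => ⟨hx.1, by have := hx.2; rw [inner_neg_left] at this; linarith⟩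
  have hcl : {x : E | x ∈ closedBall 0 r ∧ 0 ≤ ⟪-ν, x⟫} ⊆ closedBall 0 r := fun x hx => hx.1
  have hA : H (P + l₁ • ν) ≤ -η := by
    have := smul_mem_of_isGreatest_lowSlope (B := B) hν' hr (hz₁.mono hcl) (fun x hx h0 => by
      rw [inner_neg_left, neg_eq_zero] at h0
      have := (abs_le.1 (hflat₁ x hx h0)).1; linarith) hl₁ hZ₁
      fun x hx g A hg => hb₁ x (hsubset hx) g A hg
    simpa using this
  have hD : 0 ≤ H (P + (-l₂) • ν) := by
    have := smul_mem_of_isGreatest_lowSlope (B := B) hν' hr (hz₂.mono hcl) (fun x hx h0 => by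
      rw [inner_neg_left, neg_eq_zero] at h0
      have := (abs_le.1 (hflat₂ x hx h0)).1; linarith) hl₂ hZ₂
      fun x hx g A hg => hb₂ x (hsubset hx) g A hg
    simpa using this
  have hF₁ : -m₁ < l₁ → ∀ t ∈ Icc (-m₁) l₁, H (P + t • ν) ≤ -η := fun h t ht => by
    have := smul_mem_of_lowSlope (q := -t) hν hC hK₁ hK₀ hr hz₁ h0₁ hm₁.1 hl₁.1 hJ₁ hZ₁ hb₁
      (by linarith) ⟨by linarith [ht.2], by linarith [ht.1]⟩
    simpa using this
  have hF₂ : -l₂ < m₂ → ∀ t ∈ Icc (-l₂) m₂, 0 ≤ H (P + t • ν) := fun h t ht =>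
    smul_mem_of_lowSlope hν hC hK₁ hK₀ hr hz₂ h0₂ hm₂.1 hl₂.1 hJ₂ hZ₂ hb₂ h ht
  rcases lt_trichotomy l₁ (-l₂) with hlt | heq | hgt
  · have hcl : IsClosed {p | H p ≤ -η} := isClosed_le hH continuous_const
    obtain ⟨f, s, hf, hfx⟩ := geometric_hahn_banach_closed_point hconv hcl
      (x := P + (-l₂) • ν) (by rw [mem_ofPred_eq]; linarith)
    have hfA := hf _ hA
    simp only [map_add, map_smul, smul_eq_mul] at hfA hfx
    have hfν : 0 < f ν := by
      have : 0 < (-l₂ - l₁) * f ν := by linarith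
      exact (mul_pos_iff_of_pos_left (by linarith)).1 this
    set ξ := (f ν)⁻¹ • (InnerProductSpace.toDual ℝ E).symm f with hξ
    have hξg : ∀ g, ⟪ξ, g⟫ = (f ν)⁻¹ * f g := fun g => by
      rw [hξ, inner_smul_left, InnerProductSpace.toDual_symm_apply]; simp
    set c₁ := (f ν)⁻¹ * (f P - s) with hc₁
    have hlow : LowSlope (-ν) (fun x => -z₁ x) c₁ := by
      refine JetBelow.lowSlope_neg (Z := {g | H (P - g) ≤ -η}) (B := B) (ξ := ξ) hν hr ?_
        (hz₁.mono fun x hx => hx.1) (fun x hx g A hg => hb₁ x (hsubset hx) g A hg)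
        (fun x hx h0 => (abs_le.1 (hflat₁ x hx h0)).2) fun g hg => ?_
      · rw [real_inner_comm, hξg, inv_mul_cancel₀ hfν.ne']
      · have := hf _ hg
        rw [map_sub] at this
        rw [hξg, hc₁]
        gcongr
        linarith
    have hle : c₁ ≤ l₂ := hl₂.2 (hlow.mono hr hsum)
    rw [hc₁, inv_mul_le_iff₀ hfν] at hle
    linarith
  · rw [heq] at hA; linarith
  · rcases le_or_gt l₁ (-m₁) with h | h
    · have := hF₂ (by linarith) l₁ ⟨hgt.le, by linarith⟩
      linarith
    · rcases le_or_gt (-m₁) (-l₂) with h' | h'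
      · have := hF₁ h (-l₂) ⟨h', hgt.le⟩
        linarith
      · have h1 := hF₁ h (-m₁) ⟨le_rfl, h.le⟩
        have h2 := hF₂ (by linarith) (-m₁) ⟨h'.le, by linarith⟩
        linarith

end Comparison

section Quadratic

open scoped RealInnerProductSpace

theorem ConvexOn.exists_subgradient {F : Type*} [NormedAddCommGroup F] [NormedSpace ℝ F]
    {s : Set F} {f : F → ℝ} (hs : IsOpen s) (hf : ConvexOn ℝ s f) (hc : ContinuousOn f s) {x : F}
    (hx : x ∈ s) : ∃ ℓ : F →L[ℝ] ℝ, ∀ y ∈ s, f x + ℓ (y - x) ≤ f y := by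
  have hopen : IsOpen {p : F × ℝ | p.1 ∈ s ∧ f p.1 < p.2} := by
    rw [isOpen_iff_mem_nhds]
    rintro ⟨y, t⟩ ⟨hy, ht⟩
    have h1 : ContinuousAt (fun p : F × ℝ => f p.1) (y, t) :=
      (hc.continuousAt (hs.mem_nhds hy)).comp (x := (y, t)) continuousAt_fst
    filter_upwards [(hs.preimage continuous_fst).mem_nhds (x := ((y, t) : F × ℝ)) hy,
      h1.eventually_lt continuousAt_snd ht] with p h1 h2
    exact ⟨h1, h2⟩
  obtain ⟨G, hG⟩ := geometric_hahn_banach_open_point hf.convex_strict_epigraph hopen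
    (x := (x, f x)) (fun h => lt_irrefl _ h.2)
  have hsplit : ∀ y t, G (y, t) = G (y, 0) + t * G (0, 1) := fun y t => by
    rw [← smul_eq_mul, ← map_smul, ← map_add]; simp
  have hβ : G (0, 1) < 0 := by
    have := hG (x, f x + 1) ⟨hx, by simp⟩
    rw [hsplit, hsplit x (f x)] at this
    linarith
  refine ⟨(-G (0, 1))⁻¹ • G.comp (ContinuousLinearMap.inl ℝ F ℝ), fun y hy => ?_⟩
  have hle : G (y, 0) + f y * G (0, 1) ≤ G (x, 0) + f x * G (0, 1) := by
    by_contra! hcon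
    obtain ⟨δ, hδ, hlt⟩ : ∃ δ > 0, G (x, 0) + f x * G (0, 1) ≤
        G (y, 0) + (f y + δ) * G (0, 1) := by
      refine ⟨(G (y, 0) + f y * G (0, 1) - (G (x, 0) + f x * G (0, 1))) / (-G (0, 1)),
        div_pos (by linarith) (by linarith), le_of_eq ?_⟩
      have : G (0, 1) ≠ 0 := hβ.ne
      field_simp
      ring
    have := hG (y, f y + δ) ⟨hy, by simpa using hδ⟩
    rw [hsplit, hsplit x (f x)] at this
    linarith
  have hsub : G (y - x, 0) = G (y, 0) - G (x, 0) := by rw [← map_sub]; simp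
  simp only [smul_apply, ContinuousLinearMap.comp_apply,
    ContinuousLinearMap.inl_apply, smul_eq_mul, hsub]
  have : (-G (0, 1))⁻¹ * (G (y, 0) - G (x, 0)) ≤ f y - f x := by
    rw [inv_mul_le_iff₀ (by linarith)]
    linarith
  linarith

/-- The quadratic polynomial `a + ⟪g, y - x⟫ + s ⟪e, y - x⟫² + t |y - x|²`. -/
def quadAt {E : Type*} [NormedAddCommGroup E] [InnerProductSpace ℝ E] (a : ℝ) (g e : E) (s t : ℝ)
    (x y : E) : ℝ :=
  a + ⟪g, y - x⟫ + s * ⟪e, y - x⟫ ^ 2 + t * ‖y - x‖ ^ 2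

section

variable {E : Type*} [NormedAddCommGroup E] [InnerProductSpace ℝ E] (a : ℝ) (g e : E) (s t : ℝ)
  (x : E)

theorem hasFDerivAt_quadAt (y : E) :
    HasFDerivAt (quadAt a g e s t x)
      (innerSL ℝ g + (2 * s * ⟪e, y - x⟫) • innerSL ℝ e + (2 * t) • innerSL ℝ (y - x)) y := by
  have h1 : HasFDerivAt (fun y => ⟪g, y - x⟫) (innerSL ℝ g) y :=
    ((innerSL ℝ g).hasFDerivAt).comp y ((hasFDerivAt_id y).sub_const x)
  have h2 : HasFDerivAt (fun y => ⟪e, y - x⟫) (innerSL ℝ e) y :=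
    ((innerSL ℝ e).hasFDerivAt).comp y ((hasFDerivAt_id y).sub_const x)
  have h3 := ((hasFDerivAt_id y).sub_const x).norm_sq
  refine (((h1.const_add a).add ((h2.pow 2).const_mul s)).add (h3.const_mul t)).congr_fderiv ?_
  ext w
  simp
  ring

theorem contDiff_quadAt : ContDiff ℝ 2 (quadAt a g e s t x) := by
  unfold quadAt
  have h1 : ∀ e : E, ContDiff ℝ 2 fun y => ⟪e, y - x⟫ := fun e =>
    contDiff_const.inner ℝ (contDiff_id.sub contDiff_const)
  exact ((contDiff_const.add (h1 g)).add (contDiff_const.mul ((h1 e).pow 2))).add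
    (contDiff_const.mul ((contDiff_id.sub contDiff_const).norm_sq ℝ))

theorem quadAt_self : quadAt a g e s t x x = a := by simp [quadAt]

theorem gradient_quadAt_self [CompleteSpace E] : gradient (quadAt a g e s t x) x = g := by
  refine HasGradientAt.gradient ?_
  have := hasFDerivAt_quadAt a g e s t x x
  rw [hasGradientAt_iff_hasFDerivAt]
  refine this.congr_fderiv ?_
  ext w
  simp

theorem fderiv_fderiv_quadAt (y v w : E) :
    fderiv ℝ (fderiv ℝ (quadAt a g e s t x)) y v w = 2 * s * ⟪e, v⟫ * ⟪e, w⟫ + 2 * t * ⟪v, w⟫ := by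
  have hf : fderiv ℝ (quadAt a g e s t x) = fun y =>
      innerSL ℝ g + (2 * s * ⟪e, y - x⟫) • innerSL ℝ e + (2 * t) • innerSL ℝ (y - x) :=
    funext fun y => (hasFDerivAt_quadAt a g e s t x y).fderiv
  have h2 : HasFDerivAt (fun y => ⟪e, y - x⟫) (innerSL ℝ e) y :=
    ((innerSL ℝ e).hasFDerivAt).comp y ((hasFDerivAt_id y).sub_const x)
  have h3 : HasFDerivAt (fun y => innerSL ℝ (y - x)) (innerSL ℝ : E →L[ℝ] E →L[ℝ] ℝ) y :=
    ((innerSL ℝ : E →L[ℝ] E →L[ℝ] ℝ).hasFDerivAt).comp y ((hasFDerivAt_id y).sub_const x)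
  have h := (((h2.const_mul (2 * s)).smul_const (innerSL ℝ e)).const_add (innerSL ℝ g)).add
    (h3.const_smul (2 * t))
  rw [hf]
  refine (congrArg (fun T : E →L[ℝ] E →L[ℝ] ℝ => T v w) h.fderiv).trans ?_
  simp only [add_apply, ContinuousLinearMap.smulRight_apply, smul_apply,
    smul_eq_mul]
  rfl

end

theorem hessianMatrix_quadAt {n : ℕ} (a : ℝ) (g e : Euc n) (s t : ℝ) (x : Euc n) :
    hessianMatrix (quadAt a g e s t x) x =
      (2 * s) • Matrix.vecMulVec e e + (2 * t) • (1 : Matrix (Fin n) (Fin n) ℝ) := by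
  ext i j
  simp only [hessianMatrix, Matrix.of_apply, iteratedFDeriv_two_apply, Matrix.cons_val_zero,
    Matrix.cons_val_one, fderiv_fderiv_quadAt, Matrix.add_apply, Matrix.smul_apply,
    Matrix.vecMulVec_apply, Matrix.one_apply, smul_eq_mul]
  simp only [EuclideanSpace.inner_single_right]
  simp [eq_comm]
  ring

theorem trace_mul_hessian_ge {n : ℕ} {l L : ℝ} {A : Matrix (Fin n) (Fin n) ℝ}
    (hA : A ∈ pucciSet n l L) (e : Euc n) {γ : ℝ} (hγ : 0 ≤ γ) :
    2 * l * ‖e‖ ^ 2 - 2 * γ * (n * L) ≤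
      (A * ((2 : ℝ) • Matrix.vecMulVec e e + (-(2 * γ)) • (1 : Matrix (Fin n) (Fin n) ℝ))).trace := by
  obtain ⟨h1, h2⟩ := hA
  have i1 := h1.dotProduct_mulVec_nonneg e
  have i2 := h2.trace_nonneg
  rw [Matrix.sub_mulVec, dotProduct_sub, Matrix.smul_mulVec, Matrix.one_mulVec,
    dotProduct_smul, smul_eq_mul, star_trivial] at i1
  rw [Matrix.trace_sub, Matrix.trace_smul, Matrix.trace_one, Fintype.card_fin, smul_eq_mul] at i2
  have e1 : (e : Fin n → ℝ) ⬝ᵥ (e : Fin n → ℝ) = ‖e‖ ^ 2 := by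
    rw [EuclideanSpace.real_norm_sq_eq]; simp [dotProduct, pow_two]
  rw [e1] at i1
  rw [Matrix.mul_add, Matrix.mul_smul, Matrix.mul_smul, Matrix.mul_one, Matrix.trace_add,
    Matrix.trace_smul, Matrix.trace_smul, Matrix.mul_vecMulVec, Matrix.trace_vecMulVec,
    smul_eq_mul, smul_eq_mul, dotProduct_comm]
  have := mul_le_mul_of_nonneg_left i2 hγ
  linarith

theorem pucciSet_nonempty {n : ℕ} {l L : ℝ} (h : l ≤ L) : (pucciSet n l L).Nonempty := by
  refine ⟨l • 1, ?_, ?_⟩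
  · rw [sub_self]; exact Matrix.PosSemidef.zero
  · rw [← sub_smul]; exact Matrix.PosSemidef.one.smul (sub_nonneg.2 h)

end Quadratic

section Slab

open scoped RealInnerProductSpace

variable {n : ℕ}

theorem ViscPucciSuper.pucciJetSuper {l L M : ℝ} {U V : Set (Euc n)} {u : Euc n → ℝ}
    (h : ViscPucciSuper l L V u) (hl : 0 < l) (hlL : l ≤ L) (hV : IsOpen V) (hUV : U ⊆ V)
    (hM : ∀ x ∈ U, |u x| ≤ M) :
    PucciJetSuper (n * L / l) (L / (2 * l)) (L * (M + 1) / (2 * l)) U u := by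
  intro x hx g e γ hγ hy
  obtain ⟨ρ, hρ, hball⟩ := Metric.eventually_nhds_iff_ball.1 (hy.and (hV.mem_nhds (hUV hx)))
  have key := h x (quadAt (u x) g e 1 (-γ) x) ρ hρ (fun y hy => (hball y hy).2)
    (contDiff_quadAt ..).contDiffOn
    (fun y hy => by have := (hball y hy).1; simp only [quadAt]; linarith) (quadAt_self ..).symm
  rw [gradient_quadAt_self, hessianMatrix_quadAt] at key
  have hp : pucciPlus l L ((2 * 1 : ℝ) • Matrix.vecMulVec e e +
      (2 * -γ) • (1 : Matrix (Fin n) (Fin n) ℝ)) ≤ -(2 * l * ‖e‖ ^ 2 - 2 * γ * (n * L)) := by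
    refine csSup_le ((pucciSet_nonempty hlL).image _) ?_
    rintro _ ⟨A, hA, rfl⟩
    have := trace_mul_hessian_ge hA e hγ
    rw [mul_one, mul_neg]
    exact neg_le_neg this
  have h1 : max (u x) 0 ≤ M :=
    max_le ((le_abs_self _).trans (hM x hx)) ((abs_nonneg _).trans (hM x hx))
  have h2 := mul_le_mul_of_nonneg_left h1 (hl.le.trans hlL)
  rw [div_mul_eq_mul_div, div_mul_eq_mul_div, div_add_div _ _ hl.ne' (by positivity),
    div_add_div _ _ (by positivity) (by positivity), le_div_iff₀ (by positivity)]
  have h3 : 2 * l * ‖e‖ ^ 2 ≤ 2 * γ * (n * L) + L * ‖g‖ + L * (M + 1) := by linarith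
  have h4 := mul_le_mul_of_nonneg_left h3 (by positivity : 0 ≤ 2 * l * l)
  linarith

theorem ViscPucciSub.pucciJetSuper_neg {l L M : ℝ} {U V : Set (Euc n)} {u : Euc n → ℝ}
    (h : ViscPucciSub l L V u) (hl : 0 < l) (hlL : l ≤ L) (hV : IsOpen V) (hUV : U ⊆ V)
    (hM : ∀ x ∈ U, |u x| ≤ M) :
    PucciJetSuper (n * L / l) (L / (2 * l)) (L * (M + 1) / (2 * l)) U (fun x => -u x) := by
  intro x hx g e γ hγ hy
  obtain ⟨ρ, hρ, hball⟩ := Metric.eventually_nhds_iff_ball.1 (hy.and (hV.mem_nhds (hUV hx)))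
  have key := h x (quadAt (u x) (-g) e (-1) γ x) ρ hρ (fun y hy => (hball y hy).2)
    (contDiff_quadAt ..).contDiffOn
    (fun y hy => by
      have := (hball y hy).1; simp only [quadAt, inner_neg_left]; linarith) (quadAt_self ..).symm
  rw [gradient_quadAt_self, hessianMatrix_quadAt, norm_neg] at key
  have hp : 2 * l * ‖e‖ ^ 2 - 2 * γ * (n * L) ≤ pucciMinus l L ((2 * -1 : ℝ) •
      Matrix.vecMulVec e e + (2 * γ) • (1 : Matrix (Fin n) (Fin n) ℝ)) := by
    refine le_csInf ((pucciSet_nonempty hlL).image _) ?_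
    rintro _ ⟨A, hA, rfl⟩
    refine (trace_mul_hessian_ge hA e hγ).trans_eq ?_
    dsimp only
    rw [← Matrix.trace_neg, ← Matrix.mul_neg, neg_add, ← neg_smul, ← neg_smul]
    norm_num
  have h1 : max (-u x) 0 ≤ M :=
    max_le ((neg_le_abs _).trans (hM x hx)) ((abs_nonneg _).trans (hM x hx))
  have h2 := mul_le_mul_of_nonneg_left h1 (hl.le.trans hlL)
  rw [div_mul_eq_mul_div, div_mul_eq_mul_div, div_add_div _ _ hl.ne' (by positivity),
    div_add_div _ _ (by positivity) (by positivity), le_div_iff₀ (by positivity)]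
  have h3 : 2 * l * ‖e‖ ^ 2 ≤ 2 * γ * (n * L) + L * ‖g‖ + L * (M + 1) := by linarith
  have h4 := mul_le_mul_of_nonneg_left h3 (by positivity : 0 ≤ 2 * l * l)
  linarith

theorem PucciJetSuper.add_affine {E : Type*} [NormedAddCommGroup E] [InnerProductSpace ℝ E]
    {C K₁ K₀ : ℝ} {V : Set E} {z : E → ℝ}
    (h : PucciJetSuper C K₁ K₀ V z) (hK : 0 ≤ K₁) (a : E) (c : ℝ) :
    PucciJetSuper C K₁ (K₀ + K₁ * ‖a‖) V (fun y => z y + ⟪a, y⟫ + c) := by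
  simpa using h.comp_affine hK one_pos one_pos 0 a c

theorem norm_sq_eq_sum_castSucc_add (x : Euc (n + 1)) :
    ‖x‖ ^ 2 = ∑ i : Fin n, (x i.castSucc) ^ 2 + (x (Fin.last n)) ^ 2 := by
  rw [EuclideanSpace.real_norm_sq_eq, Fin.sum_univ_castSucc]

theorem isOpen_slab : IsOpen (slab n) := by
  have h1 : Continuous fun x : Euc (n + 1) => ∑ i : Fin n, (x i.castSucc) ^ 2 := by fun_prop
  have h2 : Continuous fun x : Euc (n + 1) => |x (Fin.last n)| := by fun_prop
  exact (h1.isOpen_preimage _ isOpen_Iio).inter (h2.isOpen_preimage _ isOpen_Iio)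

theorem isOpen_slabPos : IsOpen (slabPos n) := by
  have h1 : Continuous fun x : Euc (n + 1) => ∑ i : Fin n, (x i.castSucc) ^ 2 := by fun_prop
  have h2 : Continuous fun x : Euc (n + 1) => x (Fin.last n) := by fun_prop
  exact (h1.isOpen_preimage _ isOpen_Iio).inter (h2.isOpen_preimage _ isOpen_Ioo)

theorem slabLe_subset_slab : slabLe n ⊆ slab n := fun _ hx =>
  ⟨hx.1, abs_lt.2 ⟨hx.2.1, hx.2.2.trans_lt one_pos⟩⟩

theorem mem_slab_of_norm_lt_one {x : Euc (n + 1)} (hx : ‖x‖ < 1) : x ∈ slab n := by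
  have h := norm_sq_eq_sum_castSucc_add x
  have h1 : ‖x‖ ^ 2 < 1 := pow_lt_one₀ (norm_nonneg x) hx two_ne_zero
  have h2 : 0 ≤ ∑ i : Fin n, (x i.castSucc) ^ 2 := Finset.sum_nonneg fun i _ => sq_nonneg _
  exact ⟨by nlinarith [sq_nonneg (x (Fin.last n))], (sq_lt_one_iff_abs_lt_one _).1 (by linarith)⟩

theorem mem_slabLe_of_norm_lt_one {x : Euc (n + 1)} (hx : ‖x‖ < 1) (h0 : x (Fin.last n) ≤ 0) :
    x ∈ slabLe n :=
  have h := mem_slab_of_norm_lt_one hx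
  ⟨h.1, (abs_lt.1 h.2).1, h0⟩

theorem mem_slabPos_of_norm_lt_one {x : Euc (n + 1)} (hx : ‖x‖ < 1) (h0 : 0 < x (Fin.last n)) :
    x ∈ slabPos n :=
  have h := mem_slab_of_norm_lt_one hx
  ⟨h.1, h0, (abs_lt.1 h.2).2⟩

@[simp] theorem snocE_castSucc (p : Euc n) (t : ℝ) (i : Fin n) : snocE p t i.castSucc = p i := by
  simp [snocE]

@[simp] theorem snocE_last (p : Euc n) (t : ℝ) : snocE p t (Fin.last n) = t := by
  simp [snocE]

theorem snocE_zero : snocE (0 : Euc n) 0 = 0 := by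
  ext i
  refine Fin.lastCases ?_ (fun i => ?_) i <;> simp

theorem inner_snocE (p q : Euc n) : ⟪snocE p 0, snocE q 0⟫ = ⟪p, q⟫ := by
  simp [PiLp.inner_apply, Fin.sum_univ_castSucc]

theorem exists_snocE_eq {x : Euc (n + 1)} (hx : x (Fin.last n) = 0) :
    ∃ p : Euc n, snocE p 0 = x := by
  refine ⟨WithLp.toLp 2 fun i => x i.castSucc, ?_⟩
  ext i
  refine Fin.lastCases ?_ (fun i => ?_) i <;> simp [hx]

/-- Two functions that are semiconvex and semiconcave respectively, ordered and touching at the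
origin, are tangent to the same hyperplane there. -/
theorem exists_common_tangent {F : Type*} [NormedAddCommGroup F] [InnerProductSpace ℝ F]
    [FiniteDimensional ℝ F] {f g : F → ℝ} {B : ℝ}
    (hf : ConvexOn ℝ (ball (0 : F) 1) fun x => f x + B * ‖x‖ ^ 2)
    (hg : ConvexOn ℝ (ball (0 : F) 1) fun x => -g x + B * ‖x‖ ^ 2)
    (hle : ∀ x ∈ ball (0 : F) 1, f x ≤ g x) (h0 : f 0 = g 0) :
    ∃ p : F, ∀ x ∈ ball (0 : F) 1,
      |f x - f 0 - ⟪p, x⟫| ≤ B * ‖x‖ ^ 2 ∧ |g x - f 0 - ⟪p, x⟫| ≤ B * ‖x‖ ^ 2 := by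
  have hmem : (0 : F) ∈ ball (0 : F) 1 := mem_ball_self one_pos
  obtain ⟨ℓ, hℓ⟩ := hf.exists_subgradient isOpen_ball (hf.continuousOn isOpen_ball) hmem
  obtain ⟨k, hk⟩ := hg.exists_subgradient isOpen_ball (hg.continuousOn isOpen_ball) hmem
  simp only [sub_zero, norm_zero] at hℓ hk
  have hneg : ∀ y, ℓ y + k y ≤ 0 := by
    intro y
    have hlim : Tendsto (fun t : ℝ => 2 * B * t * ‖y‖ ^ 2) (𝓝[>] 0) (𝓝 (2 * B * 0 * ‖y‖ ^ 2)) :=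
      (Continuous.tendsto (by fun_prop) 0).mono_left nhdsWithin_le_nhds
    rw [mul_zero, zero_mul] at hlim
    have hball : ∀ᶠ t : ℝ in 𝓝[>] 0, t • y ∈ ball (0 : F) 1 := by
      have hc : Continuous fun t : ℝ => t • y := by fun_prop
      exact nhdsWithin_le_nhds
        ((isOpen_ball.preimage hc).mem_nhds (x := 0) (by simp))
    refine ge_of_tendsto hlim ?_
    filter_upwards [hball, self_mem_nhdsWithin] with t ht (ht0 : 0 < t)
    have h1 := hℓ _ ht
    have h2 := hk _ ht
    have h3 := hle _ ht
    simp only [map_smul, smul_eq_mul, norm_smul, Real.norm_of_nonneg ht0.le] at h1 h2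
    have : t * (ℓ y + k y) ≤ t * (2 * B * t * ‖y‖ ^ 2) := by nlinarith
    exact le_of_mul_le_mul_left this ht0
  have hk' : ∀ y, k y = -ℓ y := fun y => by
    have h1 := hneg y
    have h2 := hneg (-y)
    rw [map_neg, map_neg] at h2
    linarith
  refine ⟨(InnerProductSpace.toDual ℝ F).symm ℓ, fun x hx => ?_⟩
  rw [InnerProductSpace.toDual_symm_apply]
  have h1 := hℓ x hx
  have h2 := hk x hx
  have h3 := hle x hx
  rw [hk'] at h2
  exact ⟨abs_le.2 ⟨by linarith, by linarith⟩, abs_le.2 ⟨by linarith, by linarith⟩⟩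

end Slab

theorem statement_19 {n : ℕ} (η ε lam Lam : ℝ) (hη : 0 < η) (hε : ε ∈ Ioo (0 : ℝ) 1)
    (hlam : 0 < lam) (hLam : lam ≤ Lam)
    (H : Euc (n + 1) → ℝ) (hHC : Continuous H)
    (hqc : ∀ c : ℝ, Convex ℝ {p : Euc (n + 1) | H p ≤ c})
    (hbdd : ∀ c : ℝ, Bornology.IsBounded {p : Euc (n + 1) | H p ≤ c})
    (u v : Euc (n + 1) → ℝ)
    (huC : ContinuousOn u (slab n)) (hvC : ContinuousOn v (slab n))
    (huLip : ∃ K : NNReal, LipschitzOnWith K u (slabLe n))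
    (hvLip : ∃ K : NNReal, LipschitzOnWith K v (slabLe n))
    (hCu : ConvexOn ℝ {p : Euc n | ‖p‖ < 1}
      fun x' => u (snocE x' 0) + (1 / (2 * ε)) * ∑ i, (x' i) ^ 2)
    (hCv : ConvexOn ℝ {p : Euc n | ‖p‖ < 1}
      fun x' => -v (snocE x' 0) + (1 / (2 * ε)) * ∑ i, (x' i) ^ 2)
    (hUEu₁ : ViscPucciSuper lam Lam (slabPos n) u) (hUEu₂ : ViscPucciSub lam Lam (slabPos n) u)
    (hUEv₁ : ViscPucciSuper lam Lam (slabPos n) v) (hUEv₂ : ViscPucciSub lam Lam (slabPos n) v)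
    (husub : ∀ x₀ ∈ slabLe n, ∀ φ : Euc (n + 1) → ℝ, ∀ ρ : ℝ, SubTest (slab n) u x₀ φ ρ →
      H (gradient φ x₀) + η ≤ 0)
    (hvsup : ∀ x₀ ∈ slabLe n, ∀ φ : Euc (n + 1) → ℝ, ∀ ρ : ℝ, SupTest (slab n) v x₀ φ ρ →
      0 ≤ H (gradient φ x₀)) :
    ¬((∀ x ∈ slab n, u x ≤ v x) ∧ u 0 = v 0) := by
  rintro ⟨huv, h00⟩
  set ν : Euc (n + 1) := EuclideanSpace.single (Fin.last n) 1 with hνdef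
  have hν : ‖ν‖ = 1 := by simp [hνdef]
  have hνx : ∀ x : Euc (n + 1), inner ℝ ν x = x (Fin.last n) := fun x => by
    simp [hνdef, EuclideanSpace.inner_single_left]
  have hball : ∀ x ∈ closedBall (0 : Euc (n + 1)) (1 / 2), ‖x‖ < 1 := fun x hx => by
    rw [mem_closedBall_zero_iff] at hx; linarith
  have hsub : closedBall (0 : Euc (n + 1)) (1 / 2) ⊆ slab n := fun x hx =>
    mem_slab_of_norm_lt_one (hball x hx)
  have hunit : {p : Euc n | ‖p‖ < 1} = ball 0 1 := by ext; simp
  simp only [← EuclideanSpace.real_norm_sq_eq] at hCu hCv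
  rw [hunit] at hCu hCv
  have hnorm : ∀ p : Euc n, ‖snocE p 0‖ = ‖p‖ := fun p => by
    rw [norm_eq_sqrt_real_inner, inner_snocE, ← norm_eq_sqrt_real_inner]
  obtain ⟨p, hp⟩ := exists_common_tangent hCu hCv
    (fun x hx => huv _ (mem_slab_of_norm_lt_one (by rwa [hnorm, ← mem_ball_zero_iff])))
    (by rw [snocE_zero, h00])
  rw [snocE_zero] at hp
  set P : Euc (n + 1) := snocE p 0 with hP
  have hflat : ∀ x ∈ closedBall (0 : Euc (n + 1)) (1 / 2), inner ℝ ν x = 0 →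
      |u x - u 0 - inner ℝ P x| ≤ 1 / (2 * ε) * ‖x‖ ^ 2 ∧
        |v x - u 0 - inner ℝ P x| ≤ 1 / (2 * ε) * ‖x‖ ^ 2 := by
    intro x hx h0
    rw [hνx] at h0
    obtain ⟨q, rfl⟩ := exists_snocE_eq h0
    have := hball _ hx
    rw [hnorm] at this ⊢
    rw [hP, inner_snocE]
    exact hp q (mem_ball_zero_iff.2 this)
  obtain ⟨Ku, hKu⟩ := huLip
  obtain ⟨Kv, hKv⟩ := hvLip
  obtain ⟨Mu, hMu⟩ := (isCompact_closedBall (0 : Euc (n + 1)) (1 / 2)).exists_bound_of_continuousOn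
    (huC.mono hsub)
  obtain ⟨Mv, hMv⟩ := (isCompact_closedBall (0 : Euc (n + 1)) (1 / 2)).exists_bound_of_continuousOn
    (hvC.mono hsub)
  set U : Set (Euc (n + 1)) := {x | x ∈ ball 0 (1 / 2) ∧ 0 < inner ℝ ν x} with hU
  have hUV : U ⊆ slabPos n := fun x hx => mem_slabPos_of_norm_lt_one
    (hball x (ball_subset_closedBall hx.1)) (by rw [← hνx]; exact hx.2)
  have hbu : ∀ x ∈ U, |u x| ≤ max Mu Mv := fun x hx =>
    (hMu x (ball_subset_closedBall hx.1)).trans (le_max_left _ _)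
  have hbv : ∀ x ∈ U, |v x| ≤ max Mu Mv := fun x hx =>
    (hMv x (ball_subset_closedBall hx.1)).trans (le_max_right _ _)
  have hM0 : 0 ≤ max Mu Mv :=
    ((norm_nonneg _).trans (hMu 0 (mem_closedBall_self (by norm_num)))).trans (le_max_left _ _)
  have hL0 : 0 < Lam := hlam.trans_le hLam
  have hK₁ : 0 ≤ Lam / (2 * lam) := by positivity
  have hlow : ∀ x ∈ closedBall (0 : Euc (n + 1)) (1 / 2), inner ℝ ν x ≤ 0 → x ∈ slabLe n :=
    fun x hx h0 => mem_slabLe_of_norm_lt_one (hball x hx) (by rwa [← hνx])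
  have hPL : ∀ x y : Euc (n + 1), |inner ℝ P x - inner ℝ P y| ≤ ‖P‖ * ‖x - y‖ := fun x y => by
    rw [← inner_sub_right]; exact abs_real_inner_le_norm _ _
  have hlocal : ∀ {x : Euc (n + 1)} {q : Euc (n + 1) → Prop}, x ∈ slab n → (∀ᶠ y in 𝓝 x, q y) →
      ∃ ρ > 0, ∀ y ∈ ball x ρ, q y ∧ y ∈ slab n := fun hx hq =>
    Metric.eventually_nhds_iff_ball.1 (hq.and (isOpen_slab.mem_nhds hx))
  refine false_of_touching (C := (n + 1 : ℕ) * Lam / lam) (K₁ := Lam / (2 * lam))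
    (K₀ := Lam * (max Mu Mv + 1) / (2 * lam) + Lam / (2 * lam) * ‖P‖) (B := 1 / (2 * ε))
    (L := Ku + Kv + ‖P‖) (r := 1 / 2) (η := η) (ν := ν) (P := P) (H := H)
    (z₁ := fun x => u 0 + inner ℝ P x - u x) (z₂ := fun x => v x - u 0 - inner ℝ P x)
    hν (by positivity) hK₁ (by positivity) (by have := hε.1; positivity) (by norm_num) hη hHC
    (hqc _) ?_ ?_ (by simp) (by simp [h00]) ?_ ?_ ?_ ?_ ?_ ?_ ?_ ?_ ?_ ?_ ?_
  · exact ContinuousOn.sub (by fun_prop) (huC.mono hsub)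
  · exact ((hvC.mono hsub).sub continuousOn_const).sub (by fun_prop)
  · intro x hx
    have := huv x (hsub hx)
    linarith
  · intro x hx h0
    rw [← abs_neg]
    convert (hflat x hx h0).1 using 2
    ring
  · exact fun x hx h0 => (hflat x hx h0).2
  · intro x hx y hy hx0 hy0
    have h1 := (abs_le.1 (hKu.dist_le_mul _ (hlow x hx hx0) _ (hlow y hy hy0))).1
    have h2 := (abs_le.1 (hPL x y)).2
    rw [dist_eq_norm] at h1
    have h3 : 0 ≤ Kv * ‖x - y‖ := by positivity
    linarith
  · intro x hx y hy hx0 hy0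
    have h1 := (abs_le.1 (hKv.dist_le_mul _ (hlow x hx hx0) _ (hlow y hy hy0))).2
    have h2 := (abs_le.1 (hPL x y)).1
    rw [dist_eq_norm] at h1
    have h3 : 0 ≤ Ku * ‖x - y‖ := by positivity
    linarith
  · convert (hUEu₂.pucciJetSuper_neg hlam hLam isOpen_slabPos hUV hbu).add_affine hK₁ P (u 0)
      using 2
    ring
  · convert (hUEu₁.pucciJetSuper hlam hLam isOpen_slabPos hUV hbu).add_affine hK₁ (-P) (-u 0)
      using 2
    · rw [norm_neg]
    · rw [inner_neg_left]; ring
  · convert (hUEv₁.pucciJetSuper hlam hLam isOpen_slabPos hUV hbv).add_affine hK₁ (-P) (-u 0)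
      using 2
    · rw [norm_neg]
    · rw [inner_neg_left]; ring
  · convert (hUEv₂.pucciJetSuper_neg hlam hLam isOpen_slabPos hUV hbv).add_affine hK₁ P (u 0)
      using 2
    ring
  · rintro x ⟨hx, hx0⟩ g A hy
    have hxs := hlow x (ball_subset_closedBall hx) hx0
    obtain ⟨ρ, hρ, hq⟩ := hlocal (slabLe_subset_slab hxs) hy
    have := husub x hxs (quadAt (u x) (P - g) 0 0 A x) ρ ⟨hρ, fun y hy => (hq y hy).2,
      (contDiff_quadAt ..).contDiffOn, fun y hy => ?_, (quadAt_self ..).symm⟩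
    · rw [gradient_quadAt_self] at this
      change H (P - g) ≤ -η
      linarith
    · have := (hq y hy).1
      simp only [quadAt, inner_sub_left, inner_sub_right] at this ⊢
      linarith
  · rintro x ⟨hx, hx0⟩ g A hy
    have hxs := hlow x (ball_subset_closedBall hx) hx0
    obtain ⟨ρ, hρ, hq⟩ := hlocal (slabLe_subset_slab hxs) hy
    have := hvsup x hxs (quadAt (v x) (P + g) 0 0 (-A) x) ρ ⟨hρ, fun y hy => (hq y hy).2,
      (contDiff_quadAt ..).contDiffOn, fun y hy => ?_, (quadAt_self ..).symm⟩
    · rwa [gradient_quadAt_self] at this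
    · have := (hq y hy).1
      simp only [quadAt, inner_add_left, inner_sub_right] at this ⊢
      linarith
end
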